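/- arXiv:2004.01003 — 2 statements merged into one kernel-verified Lean document; each statement's English description precedes it below -/
import Mathlib

section
/- There exist absolute constants C, c > 0 and an integer N₀ such that the following holds. Let N > N₀ be an integer, let Δ ⊂ 𝕋 be an interval with |Δ| ≥ 1/√N, and let l be an integer. Then there exist trigonometric polynomials U₁,…,U_N on 𝕋 with pairwise disjoint spectra contained in the set of integers in (l, l + N⁵] such that: (i) ‖ ∑_{n=1}^N U_n ‖_{L²(𝕋)} ≤ C·√|Δ|; (ii) ∑_{n=1}^N |U_n(x)| ≤ C/N for every x ∈ 𝕋 \ Δ; and (iii) | { x ∈ Δ : max_{1≤m≤N} Re( ∑_{n=1}^m U_n(x) ) > √(log N) } | ≥ c·|Δ|. -/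
open MeasureTheory

/-- The complex exponential `e^{2πinx}`. -/
noncomputable def trigChar (n : ℤ) (x : ℝ) : ℂ :=
  Complex.exp (2 * Real.pi * Complex.I * n * x)

/-- The `L²` norm over one period `[0,1]` of the torus `𝕋 = ℝ/ℤ`. -/
noncomputable def l2normT {E : Type*} [NormedAddCommGroup E] (f : ℝ → E) : ℝ :=
  (∫ x in (0:ℝ)..1, ‖f x‖ ^ 2) ^ ((1:ℝ)/2)

section


open Finset

lemma tc_zero (x : ℝ) : trigChar 0 x = 1 := by simp [trigChar]

lemma tc_add (j k : ℤ) (x : ℝ) : trigChar (j + k) x = trigChar j x * trigChar k x := by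
  unfold trigChar; rw [← Complex.exp_add]; congr 1; push_cast; ring

lemma tc_norm (k : ℤ) (x : ℝ) : ‖trigChar k x‖ = 1 := by
  unfold trigChar
  rw [show (2 * Real.pi * Complex.I * k * x : ℂ) = ((2 * Real.pi * k * x : ℝ) : ℂ) * Complex.I by
    push_cast; ring]
  exact Complex.norm_exp_ofReal_mul_I _

lemma tc_cont (k : ℤ) : Continuous (trigChar k) := by
  unfold trigChar; fun_prop

lemma tc_mul_arg (k m : ℤ) (x : ℝ) : trigChar k (m * x) = trigChar (k * m) x := by
  unfold trigChar; congr 1; push_cast; ring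

lemma tc_add_arg (k : ℤ) (x y : ℝ) : trigChar k (x + y) = trigChar k x * trigChar k y := by
  unfold trigChar; rw [← Complex.exp_add]; congr 1; push_cast; ring

lemma tc_int (k m : ℤ) : trigChar k (m : ℝ) = 1 := by
  unfold trigChar
  rw [show (2 * Real.pi * Complex.I * k * ((m : ℝ) : ℂ) : ℂ) = ((k * m : ℤ) : ℂ) * (2 * Real.pi * Complex.I) by
    push_cast; ring]
  exact Complex.exp_int_mul_two_pi_mul_I _

lemma tc_conj (k : ℤ) (x : ℝ) : (starRingEnd ℂ) (trigChar k x) = trigChar (-k) x := by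
  unfold trigChar; rw [← Complex.exp_conj]; congr 1
  simp only [map_mul, map_ofNat, Complex.conj_I, Complex.conj_ofReal, map_intCast, Int.cast_neg]; ring

lemma tc_re (k : ℤ) (x : ℝ) : (trigChar k x).re = Real.cos (2 * Real.pi * k * x) := by
  unfold trigChar
  rw [show (2 * Real.pi * Complex.I * k * x : ℂ) = ((2 * Real.pi * k * x : ℝ) : ℂ) * Complex.I by
    push_cast; ring]
  exact Complex.exp_ofReal_mul_I_re _

lemma tc_hasDeriv (k : ℤ) (x : ℝ) :
    HasDerivAt (trigChar k) (2 * Real.pi * Complex.I * k * trigChar k x) x := by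
  unfold trigChar
  have h : HasDerivAt (fun y : ℝ => (2 * Real.pi * Complex.I * k * (y : ℂ) : ℂ)) (2 * Real.pi * Complex.I * k) x := by
    simpa using (Complex.ofRealCLM.hasDerivAt (x := x)).const_mul (2 * Real.pi * Complex.I * k : ℂ)
  have := h.cexp
  convert this using 1; ring

lemma tc_integral_ab (k : ℤ) (hk : k ≠ 0) (a b : ℝ) :
    ∫ x in a..b, trigChar k x = (trigChar k b - trigChar k a) / (2 * Real.pi * Complex.I * k) := by
  have hne : (2 * Real.pi * Complex.I * k : ℂ) ≠ 0 := by
    simp [Real.pi_ne_zero, hk]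
  have : ∀ x ∈ Set.uIcc a b, HasDerivAt (fun y => trigChar k y / (2 * Real.pi * Complex.I * k)) (trigChar k x) x := by
    intro x _
    have := (tc_hasDeriv k x).div_const (2 * Real.pi * Complex.I * k : ℂ)
    rwa [mul_div_cancel_left₀ _ hne] at this
  rw [intervalIntegral.integral_eq_sub_of_hasDerivAt this ((tc_cont k).intervalIntegrable _ _)]
  ring

lemma tc_integral (k : ℤ) : ∫ x in (0:ℝ)..1, trigChar k x = if k = 0 then 1 else 0 := by
  split_ifs with h
  · subst h; simp [tc_zero]
  · rw [tc_integral_ab k h]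
    have h1 := tc_int k 1
    have h0 := tc_int k 0
    push_cast at h1 h0
    rw [h1, h0]; simp

/-- integrals of finite trig sums -/
lemma tsum_integral {ι : Type*} (T : Finset ι) (φ : ι → ℤ) (b : ι → ℂ) :
    ∫ x in (0:ℝ)..1, ∑ p ∈ T, b p * trigChar (φ p) x = ∑ p ∈ T, if φ p = 0 then b p else 0 := by
  rw [intervalIntegral.integral_finsetSum]
  · apply Finset.sum_congr rfl
    intro p _
    rw [intervalIntegral.integral_const_mul, tc_integral]
    simp
  · intro p _
    exact ((continuous_const.mul (tc_cont _))).intervalIntegrable _ _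

lemma tsum_cont {ι : Type*} (T : Finset ι) (φ : ι → ℤ) (b : ι → ℂ) :
    Continuous (fun x => ∑ p ∈ T, b p * trigChar (φ p) x) :=
  continuous_finsetSum _ fun _ _ => continuous_const.mul (tc_cont _)

lemma parseval {ι : Type*} (T : Finset ι) (φ : ι → ℤ) (b : ι → ℂ) (hφ : Set.InjOn φ T) :
    ∫ x in (0:ℝ)..1, ‖∑ p ∈ T, b p * trigChar (φ p) x‖ ^ 2 = ∑ p ∈ T, ‖b p‖ ^ 2 := by
  classical
  have h1 : ∀ x : ℝ, ((‖∑ p ∈ T, b p * trigChar (φ p) x‖ ^ 2 : ℝ) : ℂ) =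
      ∑ q ∈ T ×ˢ T, (b q.1 * (starRingEnd ℂ) (b q.2)) * trigChar (φ q.1 - φ q.2) x := by
    intro x
    have := Complex.mul_conj' (∑ p ∈ T, b p * trigChar (φ p) x)
    push_cast
    rw [← this, map_sum, Finset.sum_mul_sum, Finset.sum_product]
    refine Finset.sum_congr rfl fun p _ => Finset.sum_congr rfl fun q _ => ?_
    rw [map_mul, tc_conj, sub_eq_add_neg, tc_add]; ring
  have h2 : ((∫ x in (0:ℝ)..1, ‖∑ p ∈ T, b p * trigChar (φ p) x‖ ^ 2 : ℝ) : ℂ) =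
      ((∑ p ∈ T, ‖b p‖ ^ 2 : ℝ) : ℂ) := by
    rw [← intervalIntegral.integral_ofReal]
    simp_rw [h1]
    rw [tsum_integral, Finset.sum_product]
    push_cast
    refine Finset.sum_congr rfl fun p hp => ?_
    rw [Finset.sum_eq_single p]
    · simp [Complex.mul_conj']
    · intro q hq hqp
      rw [if_neg]
      intro h
      exact hqp (hφ hq hp (by linarith))
    · intro h; exact absurd hp h
  exact_mod_cast h2

/-- L1 ≤ L2 on [0,1] -/
lemma l1_le_l2 (g : ℝ → ℝ) (hg : Continuous g) (t : ℝ) (ht : 0 ≤ t) (h : ∫ x in (0:ℝ)..1, g x ^ 2 ≤ t ^ 2) :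
    ∫ x in (0:ℝ)..1, g x ≤ t := by
  by_contra hc
  push Not at hc
  set J := ∫ x in (0:ℝ)..1, g x with hJ
  have h3 : ∫ x in (0:ℝ)..1, (g x ^ 2 - 2 * J * g x + J ^ 2) = (∫ x in (0:ℝ)..1, g x ^ 2) - J ^ 2 := by
    rw [intervalIntegral.integral_add, intervalIntegral.integral_sub, intervalIntegral.integral_const_mul]
    · rw [← hJ]; simp; ring
    all_goals exact Continuous.intervalIntegrable (by fun_prop) _ _
  have h4 : 0 ≤ ∫ x in (0:ℝ)..1, (g x ^ 2 - 2 * J * g x + J ^ 2) := by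
    apply intervalIntegral.integral_nonneg (by norm_num)
    intro x _
    nlinarith [sq_nonneg (g x - J)]
  nlinarith



noncomputable def kern (R : ℕ) (u : ℝ) : ℝ :=
  (Real.cos (Real.pi * u) ^ 2) ^ R * (4 ^ R / Nat.centralBinom R)

noncomputable def kco (R : ℕ) (c : ℤ) : ℝ :=
  (Nat.choose (2 * R) (R + c).toNat : ℝ) / Nat.centralBinom R

lemma sum_Icc_shift {β : Type*} [AddCommMonoid β] (R : ℕ) (g : ℤ → β) :
    ∑ c ∈ Finset.Icc (-(R:ℤ)) R, g c = ∑ j ∈ Finset.range (2 * R + 1), g ((j:ℤ) - R) := by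
  symm
  apply Finset.sum_nbij (fun j : ℕ => (j:ℤ) - R)
  · intro j hj; simp at hj ⊢; omega
  · intro a _ b _ h; simpa using h
  · intro c hc
    simp at hc
    refine ⟨(c + R).toNat, ?_, ?_⟩
    · simp; omega
    · simp; omega
  · intro _ _; rfl

lemma cB_pos (R : ℕ) : (0:ℝ) < Nat.centralBinom R := by exact_mod_cast Nat.centralBinom_pos R

lemma kern_expand (R : ℕ) (u : ℝ) :
    (kern R u : ℂ) = ∑ c ∈ Finset.Icc (-(R:ℤ)) R, (kco R c : ℂ) * trigChar c u := by
  rw [sum_Icc_shift]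
  set z : ℂ := Complex.exp (Real.pi * u * Complex.I) with hz
  have hz0 : z ≠ 0 := Complex.exp_ne_zero _
  have hcos : ((Real.cos (Real.pi * u) : ℝ) : ℂ) = (z + z⁻¹) / 2 := by
    rw [Complex.ofReal_cos, Complex.cos, hz, ← Complex.exp_neg]; push_cast; ring_nf
  have htc : ∀ j ∈ Finset.range (2 * R + 1), trigChar ((j:ℤ) - R) u = z ^ j * z⁻¹ ^ (2 * R - j) := by
    intro j hj
    simp at hj
    rw [hz, ← Complex.exp_neg, ← Complex.exp_nat_mul, ← Complex.exp_nat_mul, ← Complex.exp_add]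
    unfold trigChar
    congr 1
    rw [Nat.cast_sub (by omega)]
    push_cast; ring
  have hB : (Nat.centralBinom R : ℂ) ≠ 0 := by exact_mod_cast (Nat.centralBinom_pos R).ne'
  unfold kern kco
  push_cast
  have hcos' : Complex.cos (Real.pi * u) = (z + z⁻¹) / 2 := by rw [← hcos]; push_cast; rfl
  rw [hcos', ← pow_mul, div_pow, add_pow, Finset.sum_div, Finset.sum_mul]
  apply Finset.sum_congr rfl
  intro j hj
  rw [htc j hj]
  have : ((R:ℤ) + ((j:ℤ) - R)).toNat = j := by omega
  rw [this]
  have h4 : (2:ℂ) ^ (2 * R) = 4 ^ R := by rw [pow_mul]; norm_num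
  rw [h4]
  field_simp

lemma kern_nonneg (R : ℕ) (u : ℝ) : 0 ≤ kern R u := by
  unfold kern; have := cB_pos R; positivity

lemma kern_cont (R : ℕ) : Continuous (kern R) := by unfold kern; fun_prop

lemma kco_nonneg (R : ℕ) (c : ℤ) : 0 ≤ kco R c := by unfold kco; positivity

lemma kco_le (R : ℕ) (c : ℤ) : kco R c ≤ 1 := by
  unfold kco; rw [div_le_one (cB_pos R)]
  exact_mod_cast Nat.choose_le_centralBinom _ _

lemma kco_zero (R : ℕ) : kco R 0 = 1 := by
  unfold kco
  simp [Nat.centralBinom_eq_two_mul_choose]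
  exact (Nat.choose_pos (by omega)).ne'

lemma kco_neg_one (R : ℕ) (hR : 1 ≤ R) : 1 / 2 ≤ kco R (-1) := by
  unfold kco
  have h1 : ((R:ℤ) + -1).toNat = R - 1 := by omega
  rw [h1]
  have h2 := Nat.choose_succ_right_eq (2 * R) (R - 1)
  have h3 : R - 1 + 1 = R := by omega
  have h4 : 2 * R - (R - 1) = R + 1 := by omega
  rw [h3, h4, ← Nat.centralBinom_eq_two_mul_choose] at h2
  rw [le_div_iff₀ (cB_pos R)]
  have h5 : (Nat.centralBinom R : ℝ) * R = (Nat.choose (2 * R) (R - 1)) * (R + 1) := by exact_mod_cast h2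
  have hR' : (1:ℝ) ≤ R := by exact_mod_cast hR
  have := cB_pos R
  have h6 : (0:ℝ) ≤ (Nat.choose (2 * R) (R - 1)) := by positivity
  nlinarith

lemma kern_small (R : ℕ) (hR : 1 ≤ R) (u τ : ℝ) (h0 : 0 ≤ τ) (h1 : τ ≤ |u|) (h2 : |u| ≤ 1 - τ) :
    kern R u ≤ 2 * R * Real.exp (-4 * τ ^ 2 * R) := by
  unfold kern
  have hc : Real.cos (Real.pi * u) ^ 2 ≤ Real.exp (-4 * τ ^ 2) := by
    have e1 : Real.cos (Real.pi * u) ^ 2 = 1 - Real.sin (Real.pi * |u|) ^ 2 := by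
      have := Real.sin_sq_add_cos_sq (Real.pi * |u|)
      have e2 : Real.cos (Real.pi * |u|) = Real.cos (Real.pi * u) := by
        rw [← Real.cos_abs (Real.pi * u), abs_mul, abs_of_pos Real.pi_pos]
      rw [e2] at this; linarith
    have e3 : 2 * τ ≤ Real.sin (Real.pi * |u|) := by
      rcases le_total |u| (1/2) with h | h
      · have := Real.mul_le_sin (x := Real.pi * |u|) (by positivity) (by nlinarith [Real.pi_pos])
        have e4 : 2 / Real.pi * (Real.pi * |u|) = 2 * |u| := by field_simp
        linarith
      · have := Real.mul_le_sin (x := Real.pi * (1 - |u|)) (by apply mul_nonneg Real.pi_pos.le; linarith) (by nlinarith [Real.pi_pos])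
        have e4 : 2 / Real.pi * (Real.pi * (1 - |u|)) = 2 * (1 - |u|) := by field_simp
        have e5 : Real.sin (Real.pi * (1 - |u|)) = Real.sin (Real.pi * |u|) := by
          rw [mul_sub, mul_one, Real.sin_pi_sub]
        linarith
    have e6 := Real.add_one_le_exp (-4 * τ ^ 2)
    nlinarith
  have hp : (Real.cos (Real.pi * u) ^ 2) ^ R ≤ Real.exp (-4 * τ ^ 2 * R) := by
    calc _ ≤ (Real.exp (-4 * τ ^ 2)) ^ R := by gcongr
      _ = _ := by rw [← Real.exp_nat_mul]; ring_nf
  have hb : (4:ℝ) ^ R / Nat.centralBinom R ≤ 2 * R := by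
    rw [div_le_iff₀ (cB_pos R)]
    exact_mod_cast Nat.four_pow_le_two_mul_self_mul_centralBinom R (by omega)
  have := cB_pos R
  calc _ ≤ Real.exp (-4 * τ ^ 2 * R) * (2 * R) := by gcongr
    _ = _ := by ring

lemma kern_per (R : ℕ) : Function.Periodic (kern R) 1 := by
  intro u
  unfold kern
  rw [mul_add, mul_one, Real.cos_add_pi, neg_sq]

lemma kern_int_unit (R : ℕ) (x t : ℝ) : ∫ s in t..(t+1), kern R (x - s) = 1 := by
  rw [intervalIntegral.integral_comp_sub_left (fun s => kern R s) x]
  have h := (kern_per R).intervalIntegral_add_eq (x - (t+1)) 0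
  rw [show x - (t+1) + 1 = x - t by ring, zero_add] at h
  rw [h]
  have h2 : ((∫ s in (0:ℝ)..1, kern R s : ℝ) : ℂ) = 1 := by
    rw [← intervalIntegral.integral_ofReal]
    simp_rw [kern_expand]
    rw [tsum_integral (Finset.Icc (-(R:ℤ)) R) (fun c => c)]
    rw [Finset.sum_eq_single 0]
    · simp [kco_zero]
    · intro b _ hb; simp [hb]
    · intro h; simp at h
  exact_mod_cast h2

lemma int_tc_le (c : ℤ) (α β : ℝ) (h : α ≤ β) : ‖∫ s in α..β, trigChar c s‖ ≤ β - α := by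
  have := intervalIntegral.norm_integral_le_of_norm_le_const (a := α) (b := β) (f := trigChar c) (C := 1)
    (fun x _ => (tc_norm c x).le)
  rwa [one_mul, abs_of_nonneg (by linarith)] at this

lemma int_tc_le' (c : ℤ) (α β : ℝ) : ‖∫ s in α..β, trigChar c s‖ * |(c:ℝ)| ≤ 1 := by
  by_cases hc : c = 0
  · simp [hc]
  rw [tc_integral_ab c hc, norm_div]
  have h1 : ‖(2 * Real.pi * Complex.I * c : ℂ)‖ = 2 * Real.pi * |(c:ℝ)| := by
    simp [abs_of_pos Real.pi_pos]
  rw [h1]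
  have h2 : ‖trigChar c β - trigChar c α‖ ≤ 2 := by
    calc _ ≤ ‖trigChar c β‖ + ‖trigChar c α‖ := norm_sub_le _ _
      _ = 2 := by rw [tc_norm, tc_norm]; norm_num
  have hc' : 0 < |(c:ℝ)| := by positivity
  have hpi := Real.pi_gt_three
  rw [div_mul_eq_mul_div, div_le_one (by positivity)]
  nlinarith

lemma smooth_ind (α β : ℝ) (hab : α ≤ β) (hba : β ≤ α + 1) (R : ℕ) (hR : 1 ≤ R) :
    ∃ (f : ℝ → ℝ) (φ : ℤ → ℂ), Continuous f ∧
      (∀ x, (f x : ℂ) = ∑ c ∈ Finset.Icc (-(R:ℤ)) R, φ c * trigChar c x) ∧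
      (∀ x, 0 ≤ f x) ∧ (∀ x, f x ≤ 1) ∧ (∀ c, ‖φ c‖ ≤ 1) ∧ (∀ c, ‖φ c‖ * |(c:ℝ)| ≤ 1) ∧
      φ 0 = ((β - α : ℝ) : ℂ) ∧ φ (-1) = kco R (-1) * ∫ s in α..β, trigChar 1 s ∧
      (∀ x τ : ℝ, 0 ≤ τ → (∀ s ∈ Set.Icc α β, τ ≤ |x - s| ∧ |x - s| ≤ 1 - τ) →
        f x ≤ 2 * R * Real.exp (-4 * τ ^ 2 * R)) ∧
      (∀ x τ : ℝ, 0 ≤ τ → (∀ s ∈ Set.Icc β (α + 1), τ ≤ |x - s| ∧ |x - s| ≤ 1 - τ) →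
        1 - 2 * R * Real.exp (-4 * τ ^ 2 * R) ≤ f x) := by
  have hcx : ∀ x, Continuous fun s => kern R (x - s) := fun x => (kern_cont R).comp (by fun_prop)
  have hsplit : ∀ x, (∫ s in α..β, kern R (x - s)) + (∫ s in β..(α+1), kern R (x - s)) = 1 := by
    intro x
    rw [intervalIntegral.integral_add_adjacent_intervals ((hcx x).intervalIntegrable _ _) ((hcx x).intervalIntegrable _ _)]
    exact kern_int_unit R x α
  have hexp : ∀ x, ((∫ s in α..β, kern R (x - s) : ℝ) : ℂ) =
      ∑ c ∈ Finset.Icc (-(R:ℤ)) R, ((kco R c : ℂ) * ∫ s in α..β, trigChar (-c) s) * trigChar c x := by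
    intro x
    rw [← intervalIntegral.integral_ofReal]
    simp_rw [kern_expand]
    rw [intervalIntegral.integral_finsetSum]
    · apply Finset.sum_congr rfl
      intro c _
      rw [intervalIntegral.integral_const_mul, mul_assoc, ← intervalIntegral.integral_mul_const]
      congr 1
      apply intervalIntegral.integral_congr
      intro s _
      simp only
      rw [sub_eq_add_neg, tc_add_arg, mul_comm]
      congr 1
      have := tc_mul_arg c (-1) s
      push_cast at this
      rw [neg_one_mul, mul_neg_one] at this
      exact this
    · intro c _
      apply Continuous.intervalIntegrable
      exact continuous_const.mul ((tc_cont c).comp (by fun_prop))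
  have hnk : ∀ c, ‖(kco R c : ℂ)‖ ≤ 1 := by
    intro c
    rw [Complex.norm_real, Real.norm_of_nonneg (kco_nonneg R c)]; exact kco_le R c
  have hsm : ∀ x τ a b : ℝ, a ≤ b → b ≤ a + 1 → 0 ≤ τ → (∀ s ∈ Set.Icc a b, τ ≤ |x - s| ∧ |x - s| ≤ 1 - τ) →
        ∫ s in a..b, kern R (x - s) ≤ 2 * R * Real.exp (-4 * τ ^ 2 * R) := by
    intro x τ a b hab hba hτ h
    have : ∫ s in a..b, kern R (x - s) ≤ ∫ s in a..b, 2 * R * Real.exp (-4 * τ ^ 2 * R) := by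
      apply intervalIntegral.integral_mono_on hab ((hcx x).intervalIntegrable _ _) (by simp)
      intro s hs
      exact kern_small R hR _ τ hτ (h s hs).1 (h s hs).2
    rw [intervalIntegral.integral_const, smul_eq_mul] at this
    have h0 : 0 ≤ 2 * R * Real.exp (-4 * τ ^ 2 * R) := by positivity
    nlinarith
  have hnn : ∀ x a b : ℝ, a ≤ b → 0 ≤ ∫ s in a..b, kern R (x - s) := fun x a b h =>
    intervalIntegral.integral_nonneg h fun s _ => kern_nonneg R _
  refine ⟨fun x => ∫ s in α..β, kern R (x - s), fun c => (kco R c : ℂ) * ∫ s in α..β, trigChar (-c) s,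
    ?_, hexp, fun x => hnn x _ _ hab, ?_, ?_, ?_, ?_, ?_, ?_, ?_⟩
  · have h1 : Continuous fun x => (((∫ s in α..β, kern R (x - s) : ℝ) : ℂ)).re := by
      simp_rw [hexp]
      exact Complex.continuous_re.comp (tsum_cont _ (fun c => c) _)
    simpa using h1
  · intro x
    have := hsplit x
    have := hnn x β (α+1) hba
    linarith
  · intro c
    rw [norm_mul]
    have := int_tc_le (-c) α β hab
    calc _ ≤ 1 * 1 := mul_le_mul (hnk c) (by linarith) (by positivity) (by norm_num)
      _ = 1 := by norm_num
  · intro c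
    rw [norm_mul, mul_assoc]
    have := int_tc_le' (-c) α β
    push_cast at this
    rw [abs_neg] at this
    calc _ ≤ 1 * 1 := mul_le_mul (hnk c) this (by positivity) (by norm_num)
      _ = 1 := by norm_num
  · simp [kco_zero, tc_zero]
  · simp
  · intro x τ hτ h
    exact hsm x τ α β hab hba hτ h
  · intro x τ hτ h
    have := hsm x τ β (α+1) hba (by linarith) hτ h
    have := hsplit x
    linarith



noncomputable def q32 (z : ℂ) : ℝ := ‖z‖ * Real.sqrt ‖z‖

lemma q32_nonneg (z : ℂ) : 0 ≤ q32 z := by unfold q32; positivity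

lemma q32_mul (z w : ℂ) : q32 (z * w) = q32 z * q32 w := by
  unfold q32; rw [norm_mul, Real.sqrt_mul (norm_nonneg _)]; ring

lemma q32_mono (z : ℂ) (t : ℝ) (h : ‖z‖ ≤ t) : q32 z ≤ t * Real.sqrt t := by
  unfold q32
  have : 0 ≤ t := (norm_nonneg _).trans h
  gcongr

lemma Icc_succ_sum (D : ℕ) (g : ℤ → ℝ) :
    ∑ c ∈ Finset.Icc (-((D+1:ℕ):ℤ)) ((D+1:ℕ):ℤ), g c =
      g (-((D+1:ℕ):ℤ)) + (g ((D+1:ℕ):ℤ) + ∑ c ∈ Finset.Icc (-(D:ℤ)) D, g c) := by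
  have : Finset.Icc (-((D+1:ℕ):ℤ)) ((D+1:ℕ):ℤ) =
      insert (-((D+1:ℕ):ℤ)) (insert ((D+1:ℕ):ℤ) (Finset.Icc (-(D:ℤ)) D)) := by
    ext x; simp only [Finset.mem_insert, Finset.mem_Icc]; push_cast; omega
  rw [this, Finset.sum_insert, Finset.sum_insert]
  · simp
  · simp only [Finset.mem_insert, Finset.mem_Icc]; push_cast; omega

lemma q32_tele (D : ℕ) (hD : 1 ≤ D) :
    (1 / ((D:ℝ)+1)) * Real.sqrt (1 / ((D:ℝ)+1)) ≤ 2 / Real.sqrt D - 2 / Real.sqrt (D + 1) := by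
  have hD' : (1:ℝ) ≤ D := by exact_mod_cast hD
  rw [Real.sqrt_div (by norm_num), Real.sqrt_one]
  set u := Real.sqrt (D:ℝ) with hu
  set v := Real.sqrt ((D:ℝ) + 1) with hv
  have hu2 : u ^ 2 = D := Real.sq_sqrt (by linarith)
  have hv2 : v ^ 2 = D + 1 := Real.sq_sqrt (by linarith)
  have hu0 : 0 < u := Real.sqrt_pos.mpr (by linarith)
  have hv0 : 0 < v := Real.sqrt_pos.mpr (by linarith)
  have huv : u ≤ v := Real.sqrt_le_sqrt (by linarith)
  rw [← hv2, div_sub_div _ _ hu0.ne' hv0.ne', div_mul_div_comm, div_le_div_iff₀ (by positivity) (by positivity)]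
  have h1 : (v - u) * (v + u) = 1 := by nlinarith
  have h2 : u ≤ 2 * (v - u) * v ^ 2 := by
    have : 0 ≤ v - u := by linarith
    have h3 : u * (v + u) ≤ 2 * v ^ 2 := by nlinarith
    have h4 : u * ((v - u) * (v + u)) ≤ (v-u) * (2 * v ^ 2) := by nlinarith
    rw [h1] at h4; linarith
  nlinarith

lemma q32_sum (p : ℤ → ℂ) (h1 : ∀ c, ‖p c‖ ≤ 1) (h2 : ∀ c, ‖p c‖ * |(c:ℝ)| ≤ 1) (D : ℕ) (hD : 1 ≤ D) :
    ∑ c ∈ Finset.Icc (-(D:ℤ)) D, q32 (p c) ≤ 8 := by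
  have hq : ∀ c : ℤ, ∀ t : ℝ, 0 < t → |(c:ℝ)| = t → q32 (p c) ≤ (1/t) * Real.sqrt (1/t) := by
    intro c t ht hc
    apply q32_mono
    have := h2 c
    rw [hc] at this
    rw [le_div_iff₀ ht]; exact this
  have hq1 : ∀ c, q32 (p c) ≤ 1 := by
    intro c; have := q32_mono (p c) 1 (h1 c); simpa using this
  have key : ∑ c ∈ Finset.Icc (-(D:ℤ)) D, q32 (p c) ≤ 7 - 4 / Real.sqrt D := by
    induction D, hD using Nat.le_induction with
    | base =>
      have := Icc_succ_sum 0 (fun c => q32 (p c))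
      simp at this
      simp [this]
      have := hq1 (-1); have := hq1 0; have := hq1 1
      linarith
    | succ D hD ih =>
      rw [Icc_succ_sum]
      have ht := q32_tele D hD
      have a1 := hq (-((D+1:ℕ):ℤ)) (D+1) (by positivity) (by
        push_cast; rw [abs_neg, abs_of_pos (by positivity)])
      have a2 := hq (((D+1:ℕ):ℤ)) (D+1) (by positivity) (by
        push_cast; rw [abs_of_pos (by positivity)])
      have e1 : 4 / Real.sqrt ((D+1:ℕ):ℝ) = 2 * (2 / Real.sqrt ((D:ℝ) + 1)) := by push_cast; ring
      have e2 : 4 / Real.sqrt (D:ℝ) = 2 * (2 / Real.sqrt (D:ℝ)) := by ring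
      rw [e2] at ih
      rw [e1]
      linarith
  have : 0 ≤ 4 / Real.sqrt D := by positivity
  linarith

lemma int_le_const (g : ℝ → ℝ) (a b B : ℝ) (hab : a ≤ b) (hg : Continuous g)
    (h : ∀ x ∈ Set.Icc a b, g x ≤ B) : ∫ x in a..b, g x ≤ B * (b - a) := by
  have := intervalIntegral.integral_mono_on hab (hg.intervalIntegrable _ _) (by simp : IntervalIntegrable (fun _ => B) volume a b) h
  rw [intervalIntegral.integral_const, smul_eq_mul] at this
  linarith

lemma split_fun (D : ℕ) (hD : 1 ≤ D) (τ : ℝ) (hτ : 0 ≤ τ) (hτ1 : τ ≤ 1/8) :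
    ∃ (P : Bool → ℝ → ℝ) (p : Bool → ℤ → ℂ), (∀ b, Continuous (P b)) ∧
      (∀ b x, (P b x : ℂ) = ∑ c ∈ Finset.Icc (-(D:ℤ)) D, p b c * trigChar c x) ∧
      (∀ b x, 0 ≤ P b x) ∧ (∀ x, P true x + P false x = 1) ∧
      (∃ r : ℝ, 1/8 ≤ r ∧ r ≤ 1 ∧ p true (-1) = r) ∧
      (∀ b, ∑ c ∈ Finset.Icc (-(D:ℤ)) D, q32 (p b c) ≤ 8) ∧
      (∑ c ∈ Finset.Icc (-(D:ℤ)) D, ‖p true c‖ ^ 2 + ∑ c ∈ Finset.Icc (-(D:ℤ)) D, ‖p false c‖ ^ 2 ≤ 1) ∧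
      ∫ x in (0:ℝ)..1, P true x * P false x ≤ 4 * τ + 2 * D * Real.exp (-4 * τ ^ 2 * D) := by
  obtain ⟨f, φ, hc, hexp, h0, h1, hb1, hb2, hz, hm1, hs, hl⟩ :=
    smooth_ind (-1/4) (1/4) (by norm_num) (by norm_num) D hD
  set p : Bool → ℤ → ℂ := fun b c => if b then φ c else (if c = 0 then 1 else 0) - φ c with hp
  have hzz : φ 0 = 1/2 := by rw [hz]; norm_num
  have hexp2 : ∀ x, ((1 - f x : ℝ) : ℂ) = ∑ c ∈ Finset.Icc (-(D:ℤ)) D, p false c * trigChar c x := by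
    intro x
    simp only [hp, Bool.false_eq_true, if_false]
    push_cast
    rw [hexp]
    simp_rw [sub_mul, Finset.sum_sub_distrib]
    congr 1
    simp [tc_zero]
  have hpf : ∀ c, ‖p false c‖ = ‖φ c‖ := by
    intro c
    simp only [hp, Bool.false_eq_true, if_false]
    split_ifs with h
    · subst h; rw [hzz]; norm_num
    · simp
  refine ⟨fun b x => if b then f x else 1 - f x, p, ?_, ?_, ?_, ?_, ?_, ?_, ?_, ?_⟩
  · intro b; cases b <;> simp <;> fun_prop
  · intro b x; cases b
    · simpa using hexp2 x
    · simpa [hp] using hexp x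
  · intro b x; cases b
    · simp; exact h1 x
    · simp; exact h0 x
  · intro x; simp
  · refine ⟨kco D (-1) / Real.pi, ?_, ?_, ?_⟩
    · have := kco_neg_one D hD
      rw [le_div_iff₀ Real.pi_pos]
      have := Real.pi_lt_four
      linarith
    · have := kco_le D (-1)
      rw [div_le_one Real.pi_pos]
      have := Real.pi_gt_three
      linarith
    · simp only [hp, if_true]
      rw [hm1, tc_integral_ab 1 (by norm_num)]
      have e1 : trigChar 1 (1/4) = Complex.I := by
        unfold trigChar
        refine Eq.trans ?_ Complex.exp_pi_div_two_mul_I; congr 1; push_cast; ring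
      have e2 : trigChar 1 (-1/4) = -Complex.I := by
        unfold trigChar
        refine Eq.trans ?_ Complex.exp_neg_pi_div_two_mul_I; congr 1; push_cast; ring
      rw [e1, e2]
      have := Real.pi_ne_zero
      push_cast
      field_simp
      ring
  · intro b; cases b
    · exact q32_sum _ (fun c => by rw [hpf]; exact hb1 c) (fun c => by rw [hpf]; exact hb2 c) D hD
    · simpa [hp] using q32_sum φ hb1 hb2 D hD
  · have e1 := parseval (Finset.Icc (-(D:ℤ)) D) (fun c => c) (p true) (fun _ _ _ _ h => h)
    have e2 := parseval (Finset.Icc (-(D:ℤ)) D) (fun c => c) (p false) (fun _ _ _ _ h => h)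
    have e3 : ∀ x, ∑ c ∈ Finset.Icc (-(D:ℤ)) D, p true c * trigChar c x = (f x : ℂ) := by
      intro x; rw [hexp]; simp [hp]
    simp_rw [e3] at e1
    simp_rw [← hexp2] at e2
    rw [← e1, ← e2, ← intervalIntegral.integral_add]
    · have := int_le_const (fun x => ‖(f x : ℂ)‖^2 + ‖((1 - f x : ℝ) : ℂ)‖^2) 0 1 1 (by norm_num) (by fun_prop) (by
        intro x _
        simp only [Complex.norm_real, Real.norm_eq_abs, sq_abs]
        nlinarith [h0 x, h1 x])
      simpa using this
    · apply Continuous.intervalIntegrable; fun_prop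
    · apply Continuous.intervalIntegrable; fun_prop
  · simp only [if_true, Bool.false_eq_true, if_false]
    set ε := 2 * (D:ℝ) * Real.exp (-4 * τ ^ 2 * D) with hε
    have hε0 : 0 ≤ ε := by positivity
    set g := fun x => f x * (1 - f x) with hg
    have hgc : Continuous g := by fun_prop
    have hi : ∀ a b, IntervalIntegrable g volume a b := fun a b => hgc.intervalIntegrable _ _
    have hgs : ∀ x, f x ≤ ε → g x ≤ ε := by intro x h; simp only [hg]; nlinarith [h0 x, h1 x]
    have hgl : ∀ x, 1 - ε ≤ f x → g x ≤ ε := by intro x h; simp only [hg]; nlinarith [h0 x, h1 x]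
    have hg1 : ∀ x, g x ≤ 1 := by intro x; simp only [hg]; nlinarith [h0 x, h1 x]
    have i1 := int_le_const g 0 (1/4-τ) ε (by linarith) hgc (by
      intro x hx
      apply hgl; apply hl x τ hτ
      intro s hs
      rw [abs_of_nonpos (by linarith [hs.1, hx.2])]
      constructor <;> linarith [hs.1, hs.2, hx.1, hx.2])
    have i2 := int_le_const g (1/4-τ) (1/4+τ) 1 (by linarith) hgc (fun x _ => hg1 x)
    have i3 := int_le_const g (1/4+τ) (3/4-τ) ε (by linarith) hgc (by
      intro x hx
      apply hgs; apply hs x τ hτ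
      intro s hs
      rw [abs_of_nonneg (by linarith [hs.2, hx.1])]
      constructor <;> linarith [hs.1, hs.2, hx.1, hx.2])
    have i4 := int_le_const g (3/4-τ) (3/4+τ) 1 (by linarith) hgc (fun x _ => hg1 x)
    have i5 := int_le_const g (3/4+τ) 1 ε (by linarith) hgc (by
      intro x hx
      apply hgl; apply hl x τ hτ
      intro s hs
      rw [abs_of_nonneg (by linarith [hs.2, hx.1])]
      constructor <;> linarith [hs.1, hs.2, hx.1, hx.2])
    rw [← intervalIntegral.integral_add_adjacent_intervals (hi 0 (1/4-τ)) (hi _ _),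
      ← intervalIntegral.integral_add_adjacent_intervals (hi (1/4-τ) (1/4+τ)) (hi _ _),
      ← intervalIntegral.integral_add_adjacent_intervals (hi (1/4+τ) (3/4-τ)) (hi _ _),
      ← intervalIntegral.integral_add_adjacent_intervals (hi (3/4-τ) (3/4+τ)) (hi _ _)]
    nlinarith



noncomputable def ev (U : ℤ →₀ ℂ) (x : ℝ) : ℂ := ∑ k ∈ U.support, U k * trigChar k x
noncomputable def en (U : ℤ →₀ ℂ) : ℝ := ∑ k ∈ U.support, ‖U k‖ ^ 2

lemma ev_cont (U : ℤ →₀ ℂ) : Continuous (ev U) := tsum_cont U.support (fun k => k) U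

lemma en_nonneg (U : ℤ →₀ ℂ) : 0 ≤ en U := Finset.sum_nonneg fun _ _ => by positivity

lemma en_coef (U : ℤ →₀ ℂ) (h : en U ≤ 1) (k : ℤ) : ‖U k‖ ≤ 1 := by
  by_cases hk : k ∈ U.support
  · have : ‖U k‖ ^ 2 ≤ en U := Finset.single_le_sum (f := fun k => ‖U k‖ ^ 2) (fun _ _ => by positivity) hk
    nlinarith [norm_nonneg (U k)]
  · rw [Finsupp.notMem_support_iff.mp hk]; simp

lemma ev_le (U : ℤ →₀ ℂ) (h : en U ≤ 1) (x : ℝ) : ‖ev U x‖ ≤ U.support.card := by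
  unfold ev
  calc _ ≤ ∑ k ∈ U.support, ‖U k * trigChar k x‖ := norm_sum_le _ _
    _ ≤ ∑ k ∈ U.support, (1:ℝ) := by
      apply Finset.sum_le_sum; intro k _; rw [norm_mul, tc_norm, mul_one]; exact en_coef U h k
    _ = _ := by simp

lemma card_le_of_en (U : ℤ →₀ ℂ) (h : en U ≤ 1) (η : ℝ) (hη : 0 < η) (s : ℕ) (hs : 1 ≤ s * η ^ 2)
    (hU : ∀ k ∈ U.support, η ≤ ‖U k‖) : U.support.card ≤ s := by
  have h1 : ∑ k ∈ U.support, η ^ 2 ≤ en U := by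
    apply Finset.sum_le_sum; intro k hk; have := hU k hk; gcongr
  rw [Finset.sum_const, nsmul_eq_mul] at h1
  have h2 : (U.support.card : ℝ) * η ^ 2 ≤ s * η ^ 2 := by linarith
  have h3 := le_of_mul_le_mul_right h2 (by positivity)
  exact_mod_cast h3

noncomputable def fs {ι : Type} (T : Finset ι) (φ : ι → ℤ) (b : ι → ℂ) : ℤ →₀ ℂ :=
  ∑ q ∈ T, Finsupp.single (φ q) (b q)

lemma fs_apply {ι : Type} (T : Finset ι) (φ : ι → ℤ) (b : ι → ℂ) (h : Set.InjOn φ T) (q : ι) (hq : q ∈ T) :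
    fs T φ b (φ q) = b q := by
  unfold fs
  rw [Finsupp.finsetSum_apply, Finset.sum_eq_single q]
  · simp
  · intro r hr hne
    rw [Finsupp.single_apply, if_neg]
    intro he; exact hne (h hr hq he)
  · intro h; exact absurd hq h

lemma fs_supp {ι : Type} (T : Finset ι) (φ : ι → ℤ) (b : ι → ℂ) : (fs T φ b).support ⊆ T.image φ := by
  classical
  intro k hk
  by_contra hc
  rw [Finsupp.mem_support_iff] at hk
  apply hk
  unfold fs
  rw [Finsupp.finsetSum_apply]
  apply Finset.sum_eq_zero
  intro q hq
  rw [Finsupp.single_apply, if_neg]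
  intro he
  exact hc (Finset.mem_image.mpr ⟨q, hq, he⟩)

lemma fs_sum {ι : Type} {β : Type} [AddCommMonoid β] (T : Finset ι) (φ : ι → ℤ) (b : ι → ℂ) (h : Set.InjOn φ T)
    (f : ℤ → ℂ → β) (hf : ∀ k, f k 0 = 0) :
    ∑ k ∈ (fs T φ b).support, f k (fs T φ b k) = ∑ q ∈ T, f (φ q) (b q) := by
  classical
  rw [Finset.sum_subset (fs_supp T φ b)]
  · rw [Finset.sum_image (fun a ha b hb hab => h ha hb hab)]
    apply Finset.sum_congr rfl
    intro q hq; rw [fs_apply T φ b h q hq]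
  · intro k _ hk
    rw [Finsupp.notMem_support_iff.mp hk, hf]

lemma en_eq (U : ℤ →₀ ℂ) : ∫ x in (0:ℝ)..1, ‖ev U x‖ ^ 2 = en U := by
  exact parseval U.support (fun k => k) U (fun _ _ _ _ h => h)

/-- shift -/
lemma shift_poly (A : ℤ →₀ ℂ) (m : ℤ) : ∃ U : ℤ →₀ ℂ, (∀ x, ev U x = trigChar m x * ev A x) ∧
    en U = en A ∧ (∀ k ∈ U.support, k - m ∈ A.support) ∧ U.support.card ≤ A.support.card := by
  classical
  have hinj : Set.InjOn (fun k : ℤ => k + m) A.support := by intro a _ b _ h; simpa using h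
  refine ⟨fs A.support (fun k => k + m) A, ?_, ?_, ?_, ?_⟩
  · intro x
    unfold ev
    rw [fs_sum A.support (fun k => k + m) A hinj (fun k z => z * trigChar k x) (by simp), Finset.mul_sum]
    apply Finset.sum_congr rfl
    intro k _
    rw [tc_add]; ring
  · unfold en
    rw [fs_sum A.support (fun k => k + m) A hinj (fun k z => ‖z‖ ^ 2) (by simp)]
  · intro k hk
    have := fs_supp _ _ _ hk
    simp only [Finset.mem_image] at this
    obtain ⟨a, ha, rfl⟩ := this
    simpa using ha
  · exact (Finset.card_le_card (fs_supp _ _ _)).trans Finset.card_image_le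

lemma sq_le_q32 (z : ℂ) (η : ℝ) (h : ‖z‖ ≤ η) : ‖z‖ ^ 2 ≤ Real.sqrt η * q32 z := by
  unfold q32
  have h1 : ‖z‖ ^ 2 = Real.sqrt ‖z‖ * (‖z‖ * Real.sqrt ‖z‖) := by
    have := Real.mul_self_sqrt (norm_nonneg z)
    linear_combination (-‖z‖) * this
  rw [h1]
  have := Real.sqrt_le_sqrt h
  gcongr

def TSep (A : ℤ →₀ ℂ) (D : ℕ) (m : ℤ) : Prop :=
  ∀ k ∈ insert 0 A.support, ∀ k' ∈ insert 0 A.support, ∀ c : ℤ, c ≠ 0 → |c| ≤ 2 * D + 2 → k - k' ≠ c * m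

lemma TSep.inj {A : ℤ →₀ ℂ} {D : ℕ} {m : ℤ} (h : TSep A D m) :
    Set.InjOn (fun q : ℤ × ℤ => q.1 + q.2 * m) (A.support ×ˢ Finset.Icc (-(D:ℤ)) D : Finset (ℤ × ℤ)) := by
  rintro ⟨k, c⟩ hk ⟨k', c'⟩ hk' he
  simp only [Finset.coe_product, Set.mem_prod, Finset.mem_coe, Finset.mem_Icc] at hk hk' he
  by_cases hc : c' - c = 0
  · have : c' = c := by omega
    subst this
    simp at he
    rw [he]
  · exfalso
    apply h k (Finset.mem_insert_of_mem hk.1) k' (Finset.mem_insert_of_mem hk'.1) (c' - c) hc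
    · rw [abs_le]; omega
    · linarith

lemma child_poly (A : ℤ →₀ ℂ) (D : ℕ) (m : ℤ) (hm : TSep A D m) (p : ℤ → ℂ) (P : ℝ → ℝ)
    (hP : ∀ x, (P x : ℂ) = ∑ c ∈ Finset.Icc (-(D:ℤ)) D, p c * trigChar c x)
    (h8 : ∑ c ∈ Finset.Icc (-(D:ℤ)) D, q32 (p c) ≤ 8) (η : ℝ) :
    ∃ B : ℤ →₀ ℂ, (∀ k ∈ B.support, η ≤ ‖B k‖) ∧
      (∀ k ∈ B.support, ∃ k' ∈ A.support, ∃ c ∈ Finset.Icc (-(D:ℤ)) D, k = k' + c * m) ∧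
      ∑ k ∈ B.support, q32 (B k) ≤ (∑ k ∈ A.support, q32 (A k)) * 8 ∧
      en B ≤ en A * ∑ c ∈ Finset.Icc (-(D:ℤ)) D, ‖p c‖ ^ 2 ∧
      ∫ x in (0:ℝ)..1, ‖ev A x * (P (m * x) : ℂ) - ev B x‖ ^ 2 ≤
        Real.sqrt η * ((∑ k ∈ A.support, q32 (A k)) * 8) := by
  classical
  set X := A.support ×ˢ Finset.Icc (-(D:ℤ)) D with hX
  set φ : ℤ × ℤ → ℤ := fun q => q.1 + q.2 * m with hφ
  set b : ℤ × ℤ → ℂ := fun q => A q.1 * p q.2 with hb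
  set T := X.filter (fun q => η ≤ ‖b q‖) with hT
  have hinjX : Set.InjOn φ X := hm.inj
  have hTX : T ⊆ X := Finset.filter_subset _ _
  have hinj : Set.InjOn φ T := hinjX.mono (by exact_mod_cast hTX)
  have hqX : ∑ q ∈ X, q32 (b q) = (∑ k ∈ A.support, q32 (A k)) * ∑ c ∈ Finset.Icc (-(D:ℤ)) D, q32 (p c) := by
    rw [Finset.sum_mul_sum, hX, Finset.sum_product]
    simp only [hb, q32_mul]
  have hq0 : 0 ≤ ∑ k ∈ A.support, q32 (A k) := Finset.sum_nonneg fun _ _ => q32_nonneg _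
  have hqX8 : ∑ q ∈ X, q32 (b q) ≤ (∑ k ∈ A.support, q32 (A k)) * 8 := by rw [hqX]; gcongr
  refine ⟨fs T φ b, ?_, ?_, ?_, ?_, ?_⟩
  · intro k hk
    have := fs_supp _ _ _ hk
    rw [Finset.mem_image] at this
    obtain ⟨q, hq, rfl⟩ := this
    rw [fs_apply T φ b hinj q hq]
    exact (Finset.mem_filter.mp hq).2
  · intro k hk
    have := fs_supp _ _ _ hk
    rw [Finset.mem_image] at this
    obtain ⟨q, hq, rfl⟩ := this
    have := Finset.mem_product.mp (hTX hq)
    exact ⟨q.1, this.1, q.2, this.2, rfl⟩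
  · rw [fs_sum T φ b hinj (fun _ z => q32 z) (by simp [q32])]
    exact (Finset.sum_le_sum_of_subset_of_nonneg hTX fun _ _ _ => q32_nonneg _).trans hqX8
  · unfold en
    rw [fs_sum T φ b hinj (fun _ z => ‖z‖ ^ 2) (by simp)]
    calc _ ≤ ∑ q ∈ X, ‖b q‖ ^ 2 := Finset.sum_le_sum_of_subset_of_nonneg hTX fun _ _ _ => by positivity
      _ = _ := by
        rw [Finset.sum_mul_sum, hX, Finset.sum_product]
        simp only [hb, norm_mul, mul_pow]
  · have e1 : ∀ x, ev A x * (P (m * x) : ℂ) - ev (fs T φ b) x =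
        ∑ q ∈ X.filter (fun q => ¬ (η ≤ ‖b q‖)), b q * trigChar (φ q) x := by
      intro x
      have e2 : ev A x * (P (m * x) : ℂ) = ∑ q ∈ X, b q * trigChar (φ q) x := by
        rw [hP]; unfold ev
        rw [Finset.sum_mul_sum, hX, Finset.sum_product]
        apply Finset.sum_congr rfl; intro k _
        apply Finset.sum_congr rfl; intro c _
        simp only [hb, hφ]
        rw [tc_mul_arg, tc_add]; ring
      have e3 : ev (fs T φ b) x = ∑ q ∈ T, b q * trigChar (φ q) x :=
        fs_sum T φ b hinj (fun k z => z * trigChar k x) (by simp)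
      rw [e2, e3, ← Finset.sum_filter_add_sum_filter_not X (fun q => η ≤ ‖b q‖)]
      ring
    simp_rw [e1]
    rw [parseval _ _ _ (hinjX.mono (by exact_mod_cast Finset.filter_subset _ _))]
    calc _ ≤ ∑ q ∈ X.filter (fun q => ¬ (η ≤ ‖b q‖)), Real.sqrt η * q32 (b q) := by
          apply Finset.sum_le_sum
          intro q hq
          exact sq_le_q32 _ _ (not_le.mp (Finset.mem_filter.mp hq).2).le
      _ ≤ ∑ q ∈ X, Real.sqrt η * q32 (b q) :=
          Finset.sum_le_sum_of_subset_of_nonneg (Finset.filter_subset _ _) fun _ _ _ =>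
            mul_nonneg (Real.sqrt_nonneg _) (q32_nonneg _)
      _ ≤ _ := by rw [← Finset.mul_sum]; gcongr

lemma choose_m (A : ℤ →₀ ℂ) (Z : Finset ℤ) (D s z M : ℕ) (hA : A.support.card ≤ s) (hZ : Z.card ≤ z)
    (hM : z * s + (s + 1) * ((s + 1) * (4 * D + 5)) < M) :
    ∃ m : ℤ, 1 ≤ m ∧ m ≤ M ∧ TSep A D m ∧ ∀ k ∈ A.support, k + m ∉ Z := by
  classical
  set S0 := insert 0 A.support with hS0
  have hS0c : S0.card ≤ s + 1 := (Finset.card_insert_le _ _).trans (by omega)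
  set X1 := (Z ×ˢ A.support).image (fun q : ℤ × ℤ => q.1 - q.2) with hX1
  set X2 := (S0 ×ˢ (S0 ×ˢ Finset.Icc (-(2 * D + 2 : ℤ)) (2 * D + 2))).image
    (fun q : ℤ × ℤ × ℤ => (q.1 - q.2.1) / q.2.2) with hX2
  have c1 : X1.card ≤ z * s := by
    refine Finset.card_image_le.trans ?_
    rw [Finset.card_product]; exact Nat.mul_le_mul hZ hA
  have c2 : X2.card ≤ (s + 1) * ((s + 1) * (4 * D + 5)) := by
    refine Finset.card_image_le.trans ?_
    rw [Finset.card_product, Finset.card_product, Int.card_Icc]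
    refine Nat.mul_le_mul hS0c (Nat.mul_le_mul hS0c ?_)
    omega
  have hlt : (X1 ∪ X2).card < (Finset.Icc (1:ℤ) M).card := by
    rw [Int.card_Icc]
    refine (Finset.card_union_le _ _).trans_lt ?_
    omega
  obtain ⟨m, hm, hmX⟩ := Finset.exists_mem_notMem_of_card_lt_card hlt
  rw [Finset.mem_Icc] at hm
  rw [Finset.mem_union, not_or] at hmX
  refine ⟨m, hm.1, hm.2, ?_, ?_⟩
  · intro k hk k' hk' c hc hcD he
    apply hmX.2
    rw [hX2, Finset.mem_image]
    rw [abs_le] at hcD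
    refine ⟨(k, k', c), ?_, ?_⟩
    · rw [Finset.mem_product, Finset.mem_product, Finset.mem_Icc]
      exact ⟨hk, hk', by simp; omega, by simp; omega⟩
    · simp only; rw [he, Int.mul_ediv_cancel_left _ hc]
  · intro k hk hkZ
    apply hmX.1
    rw [hX1, Finset.mem_image]
    exact ⟨(k + m, k), Finset.mem_product.mpr ⟨hkZ, hk⟩, by simp⟩


noncomputable def II (f : ℝ → ℝ) : ℝ := ∫ x in (0:ℝ)..1, f x

lemma II_mono {f g : ℝ → ℝ} (hf : Continuous f) (hg : Continuous g) (h : ∀ x, f x ≤ g x) : II f ≤ II g :=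
  intervalIntegral.integral_mono_on (by norm_num) (hf.intervalIntegrable _ _) (hg.intervalIntegrable _ _) fun x _ => h x

lemma II_add {f g : ℝ → ℝ} (hf : Continuous f) (hg : Continuous g) : II (fun x => f x + g x) = II f + II g :=
  intervalIntegral.integral_add (hf.intervalIntegrable _ _) (hg.intervalIntegrable _ _)

lemma II_sub {f g : ℝ → ℝ} (hf : Continuous f) (hg : Continuous g) : II (fun x => f x - g x) = II f - II g :=
  intervalIntegral.integral_sub (hf.intervalIntegrable _ _) (hg.intervalIntegrable _ _)

lemma II_mul (a : ℝ) (f : ℝ → ℝ) : II (fun x => a * f x) = a * II f :=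
  intervalIntegral.integral_const_mul _ _

lemma II_nonneg {f : ℝ → ℝ} (h : ∀ x, 0 ≤ f x) : 0 ≤ II f :=
  intervalIntegral.integral_nonneg (by norm_num) fun x _ => h x

lemma II_const (a : ℝ) : II (fun _ => a) = a := by simp [II]

lemma II_re {f : ℝ → ℂ} (hf : Continuous f) : II (fun x => (f x).re) = (∫ x in (0:ℝ)..1, f x).re := by
  unfold II
  exact intervalIntegral.intervalIntegral_re (𝕜 := ℂ) (hf.intervalIntegrable 0 1)

lemma II_dil {g : ℝ → ℝ} (hg : Function.Periodic g 1) (hc : Continuous g) (m : ℤ) (hm : 1 ≤ m) :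
    II (fun x => g (m * x)) = II g := by
  have hm0 : (m:ℝ) ≠ 0 := by positivity
  unfold II
  rw [intervalIntegral.integral_comp_mul_left (fun x => g x) hm0]
  have h := hg.intervalIntegral_add_zsmul_eq m 0 (fun _ _ => hc.intervalIntegrable _ _)
  simp at h
  simp
  rw [h]
  field_simp

structure Cfg where
  n : ℕ
  D : ℕ
  s : ℕ
  M : ℕ
  η : ℝ
  e0 : ℝ
  δ : ℝ
  γ : ℝ
  r : ℝ
  l : ℤ
  P : Bool → ℝ → ℝ
  p : Bool → ℤ → ℂ
  hPc : ∀ b, Continuous (P b)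
  hPe : ∀ b x, (P b x : ℂ) = ∑ c ∈ Finset.Icc (-(D:ℤ)) D, p b c * trigChar c x
  hP0 : ∀ b x, 0 ≤ P b x
  hP1 : ∀ x, P true x + P false x = 1
  hr1 : 1/8 ≤ r
  hr2 : r ≤ 1
  hpr : p true (-1) = r
  h8 : ∀ b, ∑ c ∈ Finset.Icc (-(D:ℤ)) D, q32 (p b c) ≤ 8
  hen : ∑ c ∈ Finset.Icc (-(D:ℤ)) D, ‖p true c‖ ^ 2 + ∑ c ∈ Finset.Icc (-(D:ℤ)) D, ‖p false c‖ ^ 2 ≤ 1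
  hδ : ∫ x in (0:ℝ)..1, P true x * P false x ≤ δ
  hδ0 : 0 ≤ δ
  hγ0 : 0 ≤ γ
  hη : 0 < η
  hs : 1 ≤ s * η ^ 2
  hM : 2 ^ n * s * s + (s + 1) * ((s + 1) * (4 * D + 5)) < M
  hγ : Real.sqrt η * 8 ^ n ≤ γ ^ 2
  hδe : n * δ ≤ e0
  hγe : n * γ ≤ e0
  hl : (n + 1) * ((D + 1) * M : ℤ) < |l|
  hD : 1 ≤ D

structure Good (C : Cfg) (d : ℕ) (F : ℝ → ℝ) (A : ℤ →₀ ℂ) : Prop where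
  c : Continuous F
  F0 : ∀ x, 0 ≤ F x
  F1 : ∀ x, F x ≤ 1
  i1 : II (fun x => F x * (1 - F x)) ≤ d * C.δ
  i2 : II (fun x => ‖ev A x - F x‖) ≤ d * C.γ
  q : ∑ k ∈ A.support, q32 (A k) ≤ 8 ^ d
  η : ∀ k ∈ A.support, C.η ≤ ‖A k‖
  en : en A ≤ 1
  rg : ∀ k ∈ A.support, |k| ≤ d * (C.D * C.M)

lemma Cfg.P1 (C : Cfg) (b : Bool) (x : ℝ) : C.P b x ≤ 1 := by
  have := C.hP1 x
  have := C.hP0 true x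
  have := C.hP0 false x
  cases b <;> linarith

lemma Cfg.PP (C : Cfg) (b : Bool) (x : ℝ) : C.P b x * (1 - C.P b x) = C.P true x * C.P false x := by
  have := C.hP1 x
  cases b
  · rw [show C.P true x = 1 - C.P false x by linarith]; ring
  · rw [show C.P false x = 1 - C.P true x by linarith]

lemma Cfg.Pper (C : Cfg) (b : Bool) : Function.Periodic (C.P b) 1 := by
  intro x
  have : (C.P b (x+1) : ℂ) = C.P b x := by
    rw [C.hPe, C.hPe]
    apply Finset.sum_congr rfl
    intro c _
    have h := tc_int c 1
    push_cast at h
    rw [tc_add_arg, h, mul_one]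
  exact_mod_cast this

lemma Cfg.PPm (C : Cfg) (m : ℤ) (hm : 1 ≤ m) : II (fun x => C.P true (m * x) * C.P false (m * x)) ≤ C.δ := by
  have := II_dil (g := fun x => C.P true x * C.P false x) (by
    intro x; simp only; rw [C.Pper, C.Pper]) ((C.hPc _).mul (C.hPc _)) m hm
  rw [this]; exact C.hδ

lemma Cfg.Pmc (C : Cfg) (b : Bool) (m : ℤ) : Continuous (fun x : ℝ => C.P b (m * x)) :=
  (C.hPc b).comp (by fun_prop)

lemma good_step (C : Cfg) {d : ℕ} {F : ℝ → ℝ} {A : ℤ →₀ ℂ} (hG : Good C d F A) (hd : d + 1 ≤ C.n) (m : ℤ)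
    (hm1 : 1 ≤ m) (hmM : m ≤ C.M) (hsep : TSep A C.D m) :
    ∃ B : Bool → (ℤ →₀ ℂ), (∀ b, Good C (d+1) (fun x => F x * C.P b (m * x)) (B b)) ∧
      en (B true) + en (B false) ≤ en A := by
  have H := fun b => child_poly A C.D m hsep (C.p b) (C.P b) (C.hPe b) (C.h8 b) C.η
  choose B h1 h2 h3 h4 h5 using H
  have hen : en (B true) + en (B false) ≤ en A := by
    have a1 := h4 true
    have a2 := h4 false
    have a3 := C.hen
    have a4 := en_nonneg A
    nlinarith
  refine ⟨B, ?_, hen⟩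
  intro b
  have hFc := hG.c
  have hPc := C.Pmc b m
  have hBc := ev_cont (B b)
  have hAc := ev_cont A
  refine ⟨hFc.mul hPc, fun x => mul_nonneg (hG.F0 x) (C.hP0 _ _), fun x => ?_, ?_, ?_, ?_, h1 b, ?_, ?_⟩
  · exact mul_le_one₀ (hG.F1 x) (C.hP0 _ _) (C.P1 _ _)
  · have : II (fun x => F x * C.P b (m * x) * (1 - F x * C.P b (m * x))) ≤
        II (fun x => F x * (1 - F x) + C.P true (m * x) * C.P false (m * x)) := by
      apply II_mono
      · fun_prop
      · have := C.Pmc true m; have := C.Pmc false m; fun_prop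
      · intro x
        rw [← C.PP b]
        have a1 := hG.F0 x
        have a2 := hG.F1 x
        have a3 := C.hP0 b (m * x)
        have a4 := C.P1 b (m * x)
        set f := F x
        set p := C.P b (m * x)
        have b1 : 0 ≤ p * (1 - p) * (1 - f) := by
          apply mul_nonneg (mul_nonneg _ _) <;> linarith
        have b2 : 0 ≤ f * (1 - f) * (1 - p ^ 2) := by
          apply mul_nonneg (mul_nonneg _ _) <;> nlinarith
        nlinarith
    have q1 := C.Pmc true m
    have q2 := C.Pmc false m
    rw [II_add (by fun_prop) (by fun_prop)] at this
    have a1 := hG.i1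
    have a2 := C.PPm m hm1
    push_cast
    linarith
  · have hl2 : II (fun x => ‖ev A x * (C.P b (m * x) : ℂ) - ev (B b) x‖) ≤ C.γ := by
      apply l1_le_l2 _ _ _ C.hγ0
      · refine (h5 b).trans (le_trans ?_ C.hγ)
        gcongr
        calc _ ≤ (8:ℝ) ^ d * 8 := by gcongr; exact hG.q
          _ = 8 ^ (d+1) := by ring
          _ ≤ _ := pow_le_pow_right₀ (by norm_num) hd
      · fun_prop
    have : II (fun x => ‖ev (B b) x - ((F x * C.P b (m * x) : ℝ) : ℂ)‖) ≤
        II (fun x => ‖ev A x * (C.P b (m * x) : ℂ) - ev (B b) x‖ + ‖ev A x - F x‖) := by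
      apply II_mono (by fun_prop) (by fun_prop)
      intro x
      have e : ev (B b) x - ((F x * C.P b (m * x) : ℝ) : ℂ) =
        -(ev A x * (C.P b (m * x) : ℂ) - ev (B b) x) + (ev A x - F x) * (C.P b (m * x) : ℂ) := by
        push_cast; ring
      rw [e]
      refine (norm_add_le _ _).trans ?_
      rw [norm_neg, norm_mul, Complex.norm_real, Real.norm_of_nonneg (C.hP0 _ _)]
      have := C.P1 b (m * x)
      have := norm_nonneg (ev A x - F x)
      nlinarith
    rw [II_add (by fun_prop) (by fun_prop)] at this
    have a1 := hG.i2
    push_cast at this ⊢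
    linarith
  · refine (h3 b).trans ?_
    rw [pow_succ]
    have := hG.q
    gcongr
  · have a1 := hG.en
    have a2 := en_nonneg (B true)
    have a3 := en_nonneg (B false)
    cases b <;> linarith
  · intro k hk
    obtain ⟨k', hk', c, hc, rfl⟩ := h2 b k hk
    have a1 := hG.rg k' hk'
    have a2 : |c * m| ≤ C.D * C.M := by
      rw [abs_mul]
      rw [Finset.mem_Icc] at hc
      have : |c| ≤ C.D := abs_le.mpr hc
      have : |m| ≤ C.M := abs_le.mpr ⟨by omega, hmM⟩
      gcongr
    have a3 := abs_add_le k' (c * m)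
    push_cast
    linarith

noncomputable def wt (l : ℤ) (x : ℝ) : ℝ := 1 + (trigChar l x).re

lemma wt_cont (l : ℤ) : Continuous (wt l) := by
  have := tc_cont l
  unfold wt; fun_prop

lemma wt_nonneg (l : ℤ) (x : ℝ) : 0 ≤ wt l x := by
  have h := Complex.abs_re_le_norm (trigChar l x)
  rw [tc_norm, abs_le] at h
  unfold wt; linarith

lemma wt_le (l : ℤ) (x : ℝ) : wt l x ≤ 2 := by
  have h := Complex.abs_re_le_norm (trigChar l x)
  rw [tc_norm, abs_le] at h
  unfold wt; linarith

lemma wt_eq (l : ℤ) (x : ℝ) : (wt l x : ℂ) = 1 + 1/2 * trigChar l x + 1/2 * trigChar (-l) x := by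
  unfold wt
  push_cast
  rw [Complex.re_eq_add_conj, tc_conj]
  ring

/-- integral of character times product -/
lemma int_prod (C : Cfg) {d : ℕ} {F : ℝ → ℝ} {A : ℤ →₀ ℂ} (hG : Good C d F A) (j m : ℤ) :
    ∫ x in (0:ℝ)..1, trigChar j x * ((C.P true (m * x) : ℂ) * (trigChar m x * ev A x)) =
      ∑ q ∈ A.support ×ˢ Finset.Icc (-(C.D:ℤ)) C.D,
        if j + m + q.1 + q.2 * m = 0 then A q.1 * C.p true q.2 else 0 := by
  have := tsum_integral (A.support ×ˢ Finset.Icc (-(C.D:ℤ)) C.D) (fun q => j + m + q.1 + q.2 * m)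
    (fun q => A q.1 * C.p true q.2)
  rw [← this]
  congr 1
  funext x
  rw [C.hPe, ev, Finset.sum_product, Finset.mul_sum, Finset.mul_sum, Finset.mul_sum]
  apply Finset.sum_congr rfl
  intro k _
  rw [Finset.sum_mul, Finset.mul_sum]
  apply Finset.sum_congr rfl
  intro c _
  rw [tc_mul_arg, tc_add, tc_add, tc_add]
  ring

lemma ev_int (A : ℤ →₀ ℂ) : ∫ x in (0:ℝ)..1, ev A x = A 0 := by
  have := tsum_integral A.support (fun k => k) A
  unfold ev
  rw [this, Finset.sum_ite_eq']
  split_ifs with h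
  · rfl
  · exact (Finsupp.notMem_support_iff.mp h).symm

lemma main_exact (C : Cfg) {d : ℕ} {F : ℝ → ℝ} {A : ℤ →₀ ℂ} (hG : Good C d F A) (hd : d ≤ C.n) (m : ℤ)
    (hm1 : 1 ≤ m) (hmM : m ≤ C.M) (hsep : TSep A C.D m) :
    II (fun x => wt C.l x * (C.P true (m * x) * (trigChar C.l x * (trigChar m x * ev A x)).re)) =
      1/2 * (C.r * (A 0).re) := by
  set g : ℝ → ℂ := fun x => (C.P true (m * x) : ℂ) * (trigChar m x * ev A x) with hg
  have hgc : Continuous g := by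
    have := C.Pmc true m; have := tc_cont m; have := ev_cont A
    fun_prop
  have hz : ∀ j : ℤ, |C.l| ≤ |j| → ∫ x in (0:ℝ)..1, trigChar j x * g x = 0 := by
    intro j hj
    rw [int_prod C hG]
    apply Finset.sum_eq_zero
    rintro ⟨k, c⟩ hq
    rw [Finset.mem_product, Finset.mem_Icc] at hq
    rw [if_neg]
    have a1 := hG.rg k hq.1
    have a2 : |(1 + c) * m| ≤ (C.D + 1) * C.M := by
      rw [abs_mul]
      have : |1 + c| ≤ C.D + 1 := abs_le.mpr (by simp only at hq; constructor <;> omega)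
      have : |m| ≤ C.M := abs_le.mpr ⟨by omega, hmM⟩
      gcongr
    have a3 : (d:ℤ) * (C.D * C.M) ≤ C.n * ((C.D + 1) * C.M) := by
      gcongr
      omega
    have a4 := C.hl
    simp only
    intro he
    have a5 : |j| ≤ |k| + |(1 + c) * m| := by
      have : j = -(k + (1 + c) * m) := by linarith
      rw [this, abs_neg]; exact abs_add_le _ _
    nlinarith
  have h0 : ∫ x in (0:ℝ)..1, trigChar 0 x * g x = C.r * A 0 := by
    rw [int_prod C hG]
    have hne : ∀ k ∈ A.support, ∀ c ∈ Finset.Icc (-(C.D:ℤ)) C.D, c ≠ -1 → 0 + m + k + c * m ≠ 0 := by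
      intro k hk c hc hne he
      rw [Finset.mem_Icc] at hc
      apply hsep 0 (Finset.mem_insert_self _ _) k (Finset.mem_insert_of_mem hk) (c + 1) (by omega)
      · rw [abs_le]; constructor <;> omega
      · linarith
    by_cases hA : (0:ℤ) ∈ A.support
    · rw [Finset.sum_eq_single ((0:ℤ), (-1:ℤ))]
      · simp [C.hpr]; ring
      · rintro ⟨k, c⟩ hq hqne
        rw [Finset.mem_product] at hq
        rw [if_neg]
        simp only
        by_cases hc : c = -1
        · subst hc
          intro he
          apply hqne
          have : k = 0 := by linarith
          rw [this]
        · exact hne k hq.1 c hq.2 hc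
      · intro hno
        exfalso; apply hno
        rw [Finset.mem_product, Finset.mem_Icc]
        have := C.hD
        exact ⟨hA, by simp only; omega, by simp only; omega⟩
    · rw [Finsupp.notMem_support_iff.mp hA, mul_zero]
      apply Finset.sum_eq_zero
      rintro ⟨k, c⟩ hq
      rw [Finset.mem_product] at hq
      rw [if_neg]
      simp only
      by_cases hc : c = -1
      · subst hc
        intro he
        have : k = 0 := by linarith
        subst this
        exact hA hq.1
      · exact hne k hq.1 c hq.2 hc
  have hl2 : |C.l| ≤ |C.l + C.l| := by
    rw [← two_mul, abs_mul]; have := abs_nonneg C.l; norm_num; linarith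
  have e1 : ∀ x, wt C.l x * (C.P true (m * x) * (trigChar C.l x * (trigChar m x * ev A x)).re) =
      (trigChar C.l x * g x + (1/2 * (trigChar (C.l + C.l) x * g x) + 1/2 * (trigChar 0 x * g x))).re := by
    intro x
    rw [← Complex.re_ofReal_mul, ← Complex.re_ofReal_mul, wt_eq]
    congr 1
    simp only [hg]
    have : trigChar 0 x = trigChar (-C.l) x * trigChar C.l x := by rw [← tc_add]; simp
    rw [this, tc_add]
    ring
  have hct : ∀ j, Continuous (fun x => trigChar j x * g x) := fun j => (tc_cont j).mul hgc
  have hci : ∀ j, IntervalIntegrable (fun x => trigChar j x * g x) volume 0 1 :=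
    fun j => (hct j).intervalIntegrable (μ := volume) 0 1
  simp_rw [e1]
  rw [II_re]
  · rw [intervalIntegral.integral_add (hci _), intervalIntegral.integral_add,
      intervalIntegral.integral_const_mul, intervalIntegral.integral_const_mul, hz _ le_rfl, hz _ hl2, h0]
    · have : (0 + (1 / 2 * 0 + 1 / 2 * ((C.r:ℂ) * A 0)) : ℂ) = ((1/2 * C.r : ℝ) : ℂ) * A 0 := by push_cast; ring
      rw [this, Complex.re_ofReal_mul]; ring
    · exact (hci _).const_mul _
    · exact (hci _).const_mul _
    · exact ((hci _).const_mul _).add ((hci _).const_mul _)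
  · exact (hct _).add ((continuous_const.mul (hct _)).add (continuous_const.mul (hct _)))

lemma Good.e1 {C : Cfg} {d : ℕ} {F : ℝ → ℝ} {A : ℤ →₀ ℂ} (hG : Good C d F A) (hd : d ≤ C.n) :
    II (fun x => F x * (1 - F x)) ≤ C.e0 := by
  have := hG.i1
  have h2 := C.hδe
  have h3 := C.hδ0
  have : (d:ℝ) * C.δ ≤ C.n * C.δ := by gcongr
  linarith

lemma Good.e2 {C : Cfg} {d : ℕ} {F : ℝ → ℝ} {A : ℤ →₀ ℂ} (hG : Good C d F A) (hd : d ≤ C.n) :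
    II (fun x => ‖ev A x - F x‖) ≤ C.e0 := by
  have := hG.i2
  have h2 := C.hγe
  have h3 := C.hγ0
  have : (d:ℝ) * C.γ ≤ C.n * C.γ := by gcongr
  linarith

lemma Cfg.e00 (C : Cfg) : 0 ≤ C.e0 := by
  have h2 := C.hγe
  have h3 := C.hγ0
  have : 0 ≤ (C.n:ℝ) * C.γ := by positivity
  linarith

lemma main_int (C : Cfg) {d : ℕ} {F : ℝ → ℝ} {A : ℤ →₀ ℂ} (hG : Good C d F A) (hd : d ≤ C.n) (m : ℤ)
    (hm1 : 1 ≤ m) (hmM : m ≤ C.M) (hsep : TSep A C.D m) :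
    1/16 * II F - 5 * C.e0 ≤
      II (fun x => wt C.l x * (F x * C.P true (m * x) * (trigChar C.l x * (trigChar m x * ev A x)).re)) := by
  have hFc := hG.c
  have hPc := C.Pmc true m
  have hw := wt_cont C.l
  have ht := tc_cont C.l
  have ht2 := tc_cont m
  have hA := ev_cont A
  have key : II (fun x => wt C.l x * (C.P true (m * x) * (trigChar C.l x * (trigChar m x * ev A x)).re)) -
      2 * (II (fun x => F x * (1 - F x)) + II (fun x => ‖ev A x - F x‖)) ≤
      II (fun x => wt C.l x * (F x * C.P true (m * x) * (trigChar C.l x * (trigChar m x * ev A x)).re)) := by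
    rw [← II_add (by fun_prop) (by fun_prop), ← II_mul, ← II_sub (by fun_prop) (by fun_prop)]
    apply II_mono (by fun_prop) (by fun_prop)
    intro x
    have hre : |(trigChar C.l x * (trigChar m x * ev A x)).re| ≤ ‖ev A x‖ := by
      refine (Complex.abs_re_le_norm _).trans ?_
      rw [norm_mul, norm_mul, tc_norm, tc_norm, one_mul, one_mul]
    set R := (trigChar C.l x * (trigChar m x * ev A x)).re
    have hAF : ‖ev A x‖ ≤ F x + ‖ev A x - F x‖ := by
      calc ‖ev A x‖ = ‖(F x : ℂ) + (ev A x - F x)‖ := by ring_nf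
        _ ≤ _ := norm_add_le _ _
        _ = _ := by rw [Complex.norm_real, Real.norm_of_nonneg (hG.F0 x)]
    have hw0 := wt_nonneg C.l x
    have hw2 := wt_le C.l x
    have hp0 := C.hP0 true (m * x)
    have hp1 := C.P1 true (m * x)
    have hF0 := hG.F0 x
    have hF1 := hG.F1 x
    set t := ‖ev A x - F x‖
    have ht0 : 0 ≤ t := norm_nonneg _
    set w := wt C.l x
    set p := C.P true (m * x)
    set f := F x
    have h1 : (1 - f) * |R| ≤ f * (1 - f) + t := by
      have : (1 - f) * |R| ≤ (1 - f) * (f + t) := by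
        apply mul_le_mul_of_nonneg_left _ (by linarith); linarith
      nlinarith
    have h2 : w * p * ((1 - f) * |R|) ≤ 2 * (f * (1 - f) + t) := by
      have : w * p ≤ 2 := by nlinarith
      have h0 : 0 ≤ (1 - f) * |R| := mul_nonneg (by linarith) (abs_nonneg _)
      have : 0 ≤ w * p := by positivity
      nlinarith
    have h3 : w * p * (1 - f) * R ≤ w * p * (1 - f) * |R| := by
      apply mul_le_mul_of_nonneg_left (le_abs_self _)
      apply mul_nonneg (by positivity); linarith
    nlinarith
  rw [main_exact C hG hd m hm1 hmM hsep] at key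
  have k1 := hG.e1 hd
  have k2 := hG.e2 hd
  have k3 : II F - II (fun x => ‖ev A x - F x‖) ≤ (A 0).re := by
    rw [← ev_int, ← II_re hA, ← II_sub hFc (by fun_prop)]
    apply II_mono (by fun_prop) (by fun_prop)
    intro x
    have := Complex.abs_re_le_norm (ev A x - F x)
    rw [Complex.sub_re, Complex.ofReal_re, abs_le] at this
    linarith [this.1]
  have k4 : 0 ≤ II F := II_nonneg hG.F0
  have k5 := C.hr1
  have k6 := C.hr2
  have k7 := C.e00
  have k8 : C.r * (II F - C.e0) ≤ C.r * (A 0).re := by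
    apply mul_le_mul_of_nonneg_left _ (by linarith); linarith
  nlinarith


noncomputable def GG (l : ℤ) : List (ℤ →₀ ℂ) → ℝ → ℝ
  | [], _ => 0
  | U :: L, x => max 0 ((trigChar l x * ev U x).re + GG l L x)

noncomputable def SS (L : List (ℤ →₀ ℂ)) (x : ℝ) : ℂ := (L.map (fun U => ev U x)).sum
noncomputable def SN (L : List (ℤ →₀ ℂ)) (x : ℝ) : ℝ := (L.map (fun U => ‖ev U x‖)).sum

lemma SS_nil (x : ℝ) : SS [] x = 0 := by simp [SS]
lemma SS_cons (U : ℤ →₀ ℂ) (L : List (ℤ →₀ ℂ)) (x : ℝ) : SS (U :: L) x = ev U x + SS L x := by simp [SS]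
lemma SN_nil (x : ℝ) : SN [] x = 0 := by simp [SN]
lemma SN_cons (U : ℤ →₀ ℂ) (L : List (ℤ →₀ ℂ)) (x : ℝ) : SN (U :: L) x = ‖ev U x‖ + SN L x := by simp [SN]
lemma SN_append (L L' : List (ℤ →₀ ℂ)) (x : ℝ) : SN (L ++ L') x = SN L x + SN L' x := by simp [SN]

lemma SS_cont (L : List (ℤ →₀ ℂ)) : Continuous (SS L) := by
  induction L with
  | nil => simp only [funext SS_nil]; fun_prop
  | cons U L ih =>
    have := ev_cont U
    simp only [funext (SS_cons U L)]; fun_prop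

lemma SN_cont (L : List (ℤ →₀ ℂ)) : Continuous (SN L) := by
  induction L with
  | nil => simp only [funext SN_nil]; fun_prop
  | cons U L ih =>
    have := ev_cont U
    simp only [funext (SN_cons U L)]; fun_prop

lemma SS_le (L : List (ℤ →₀ ℂ)) (x : ℝ) : ‖SS L x‖ ≤ SN L x := by
  induction L with
  | nil => simp [SS_nil, SN_nil]
  | cons U L ih => rw [SS_cons, SN_cons]; refine (norm_add_le _ _).trans ?_; linarith

lemma GG_nonneg (l : ℤ) (L : List (ℤ →₀ ℂ)) (x : ℝ) : 0 ≤ GG l L x := by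
  cases L with
  | nil => simp [GG]
  | cons U L => simp [GG]

lemma GG_cont (l : ℤ) (L : List (ℤ →₀ ℂ)) : Continuous (GG l L) := by
  induction L with
  | nil => simp only [funext (fun x => (by simp [GG] : GG l [] x = 0))]; fun_prop
  | cons U L ih =>
    have := ev_cont U
    have := tc_cont l
    have h : GG l (U :: L) = fun x => max 0 ((trigChar l x * ev U x).re + GG l L x) := by
      funext x; simp [GG]
    rw [h]; fun_prop

lemma re_le_ev (l : ℤ) (U : ℂ) (x : ℝ) : |(trigChar l x * U).re| ≤ ‖U‖ := by
  refine (Complex.abs_re_le_norm _).trans ?_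
  rw [norm_mul, tc_norm, one_mul]

lemma GG_le (l : ℤ) (L : List (ℤ →₀ ℂ)) (x : ℝ) : GG l L x ≤ SN L x := by
  induction L with
  | nil => simp [GG, SN_nil]
  | cons U L ih =>
    rw [SN_cons]
    simp only [GG]
    have := (abs_le.mp (re_le_ev l (ev U x) x)).2
    have h0 := GG_nonneg l L x
    apply max_le
    · have := norm_nonneg (ev U x); linarith
    · linarith

lemma GG_app1 (l : ℤ) (L L' : List (ℤ →₀ ℂ)) (x : ℝ) : GG l L x ≤ GG l (L ++ L') x := by
  induction L with
  | nil => simp [GG]; exact GG_nonneg _ _ _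
  | cons U L ih =>
    simp only [List.cons_append, GG]
    apply max_le_max le_rfl; linarith

lemma GG_app2 (l : ℤ) (L L' : List (ℤ →₀ ℂ)) (x : ℝ) :
    (trigChar l x * SS L x).re + GG l L' x ≤ GG l (L ++ L') x := by
  induction L with
  | nil => simp [SS_nil]
  | cons U L ih =>
    simp only [List.cons_append, GG]
    refine le_trans ?_ (le_max_right _ _)
    rw [SS_cons, mul_add, Complex.add_re]
    linarith

lemma GG_attain (l : ℤ) (L : List (ℤ →₀ ℂ)) (x : ℝ) :
    ∃ j ≤ L.length, GG l L x = (trigChar l x * SS (L.take j) x).re := by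
  induction L with
  | nil => exact ⟨0, le_rfl, by simp [GG, SS_nil]⟩
  | cons U L ih =>
    obtain ⟨j, hj, he⟩ := ih
    simp only [GG]
    rcases max_choice 0 ((trigChar l x * ev U x).re + GG l L x) with h | h
    · exact ⟨0, by simp, by rw [h]; simp [SS_nil]⟩
    · refine ⟨j + 1, by simpa using hj, ?_⟩
      rw [h, he, List.take_succ_cons, SS_cons, mul_add, Complex.add_re]

def suppL : List (ℤ →₀ ℂ) → Finset ℤ
  | [] => ∅
  | U :: L => U.support ∪ suppL L

lemma suppL_sub (L : List (ℤ →₀ ℂ)) (U : ℤ →₀ ℂ) (hU : U ∈ L) : U.support ⊆ suppL L := by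
  induction L with
  | nil => simp at hU
  | cons V L ih =>
    rw [List.mem_cons] at hU
    simp only [suppL]
    rcases hU with rfl | h
    · exact Finset.subset_union_left
    · exact (ih h).trans Finset.subset_union_right

lemma suppL_card (L : List (ℤ →₀ ℂ)) (s : ℕ) (h : ∀ U ∈ L, U.support.card ≤ s) :
    (suppL L).card ≤ L.length * s := by
  induction L with
  | nil => simp [suppL]
  | cons V L ih =>
    simp only [suppL]
    refine (Finset.card_union_le _ _).trans ?_
    have h1 := ih fun U hU => h U (List.mem_cons_of_mem _ hU)
    have h2 := h V (List.mem_cons_self)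
    rw [List.length_cons]
    nlinarith

theorem tree (C : Cfg) : ∀ (h d : ℕ) (F : ℝ → ℝ) (A : ℤ →₀ ℂ) (Z : Finset ℤ), d + h = C.n → Good C d F A →
    Z.card + 2 ^ h * C.s ≤ 2 ^ C.n * C.s →
    ∃ L : List (ℤ →₀ ℂ), L.length + 1 = 2 ^ h ∧ L.Pairwise (fun U V => Disjoint U.support V.support) ∧
      (∀ U ∈ L, Disjoint U.support Z ∧ U.support.card ≤ C.s ∧ en U ≤ 1 ∧
        ∀ k ∈ U.support, |k| ≤ C.n * (C.D * C.M) + C.M) ∧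
      (L.map en).sum ≤ h * en A ∧
      ∃ E : ℝ → ℝ, Continuous E ∧ (∀ x, 0 ≤ E x) ∧ II E ≤ (2 ^ h - 1) * C.e0 ∧
        (∀ x, SN L x ≤ h * F x + E x) ∧
        1/16 * h * II F - 10 * 4 ^ h * C.e0 ≤ II (fun x => wt C.l x * (F x * GG C.l L x)) := by
  intro h
  induction h with
  | zero =>
    intro d F A Z hd hG hZ
    refine ⟨[], by simp, by simp, by simp, by simp, fun _ => 0, by fun_prop, by simp, ?_, ?_, ?_⟩
    · rw [II_const]; simp
    · simp [SN_nil]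
    · simp only [GG, mul_zero]
      rw [II_const]
      have := C.e00
      simp; linarith
  | succ h ih =>
    intro d F A Z hd hG hZ
    have hAs : A.support.card ≤ C.s := card_le_of_en A hG.en C.η C.hη C.s C.hs hG.η
    obtain ⟨m, hm1, hmM, hsep, hmZ⟩ := choose_m A Z C.D C.s (2 ^ C.n * C.s) C.M hAs (by omega) C.hM
    obtain ⟨B, hB, hBen⟩ := good_step C hG (by omega) m hm1 hmM hsep
    obtain ⟨U, hUev, hUen, hUs, hUc⟩ := shift_poly A m
    have hpow : 1 ≤ 2 ^ h := Nat.one_le_two_pow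
    -- left
    have hZ1 : (Z ∪ U.support).card + 2 ^ h * C.s ≤ 2 ^ C.n * C.s := by
      have := Finset.card_union_le Z U.support
      have e : 2 ^ (h+1) * C.s = 2 ^ h * C.s + 2 ^ h * C.s := by ring
      have : C.s ≤ 2 ^ h * C.s := Nat.le_mul_of_pos_left _ (by omega)
      omega
    obtain ⟨Ll, hl1, hl2, hl3, hl4, El, hl5, hl6, hl7, hl8, hl9⟩ := ih (d+1) _ (B false) _ (by omega) (hB false) hZ1
    have hZ2 : (Z ∪ U.support ∪ suppL Ll).card + 2 ^ h * C.s ≤ 2 ^ C.n * C.s := by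
      have a1 := Finset.card_union_le Z U.support
      have a2 := Finset.card_union_le (Z ∪ U.support) (suppL Ll)
      have a3 := suppL_card Ll C.s fun V hV => (hl3 V hV).2.1
      have e : 2 ^ (h+1) * C.s = 2 ^ h * C.s + 2 ^ h * C.s := by ring
      have e2 : 2 ^ h * C.s = Ll.length * C.s + C.s := by rw [← hl1]; ring
      omega
    obtain ⟨Lr, hr1, hr2, hr3, hr4, Er, hr5, hr6, hr7, hr8, hr9⟩ := ih (d+1) _ (B true) _ (by omega) (hB true) hZ2
    have hnn : (d:ℤ) ≤ C.n := by omega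
    have hFc := hG.c
    have hAc := ev_cont A
    have hUc' := ev_cont U
    have hPt := C.Pmc true m
    have hPf := C.Pmc false m
    have hw := wt_cont C.l
    have ht := tc_cont C.l
    have htm := tc_cont m
    have hnU : ∀ x, ‖ev U x‖ = ‖ev A x‖ := by intro x; rw [hUev, norm_mul, tc_norm, one_mul]
    have hAF : ∀ x, ‖ev A x‖ ≤ F x + ‖ev A x - F x‖ := by
      intro x
      calc ‖ev A x‖ = ‖(F x : ℂ) + (ev A x - F x)‖ := by ring_nf
        _ ≤ _ := norm_add_le _ _
        _ = _ := by rw [Complex.norm_real, Real.norm_of_nonneg (hG.F0 x)]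
    have hSplit : ∀ x, F x = F x * C.P false (m * x) + F x * C.P true (m * x) := by
      intro x
      have := C.hP1 (m * x)
      linear_combination (-F x) * this
    have hdn : d ≤ C.n := by omega
    refine ⟨Ll ++ (U :: Lr), ?_, ?_, ?_, ?_, fun x => El x + Er x + ‖ev A x - F x‖, by fun_prop, ?_, ?_, ?_, ?_⟩
    · rw [List.length_append, List.length_cons, pow_succ]; omega
    · rw [List.pairwise_append, List.pairwise_cons]
      refine ⟨hl2, ⟨?_, hr2⟩, ?_⟩
      · intro V hV
        have := (hr3 V hV).1
        rw [Finset.disjoint_union_right, Finset.disjoint_union_right] at this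
        exact this.1.2.symm
      · intro V hV W hW
        rw [List.mem_cons] at hW
        rcases hW with rfl | hW
        · have := (hl3 V hV).1
          rw [Finset.disjoint_union_right] at this
          exact this.2
        · have := (hr3 W hW).1
          rw [Finset.disjoint_union_right] at this
          exact (Finset.disjoint_of_subset_right (suppL_sub Ll V hV) this.2).symm
    · intro V hV
      rw [List.mem_append, List.mem_cons] at hV
      rcases hV with hV | rfl | hV
      · have := (hl3 V hV)
        rw [Finset.disjoint_union_right] at this
        exact ⟨this.1.1, this.2⟩
      · refine ⟨?_, hUc.trans hAs, hUen ▸ hG.en, ?_⟩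
        · rw [Finset.disjoint_left]
          intro k hk hkZ
          apply hmZ (k - m) (hUs k hk)
          simpa using hkZ
        · intro k hk
          have a1 := hG.rg _ (hUs k hk)
          have a2 : |k| ≤ |k - m| + |m| := by
            have := abs_add_le (k - m) m; simpa using this
          have a3 : |m| ≤ C.M := abs_le.mpr ⟨by omega, hmM⟩
          have a4 : (d:ℤ) * (C.D * C.M) ≤ C.n * (C.D * C.M) := by gcongr
          linarith
      · have := (hr3 V hV)
        rw [Finset.disjoint_union_right, Finset.disjoint_union_right] at this
        exact ⟨this.1.1.1, this.2⟩
    · rw [List.map_append, List.sum_append, List.map_cons, List.sum_cons, hUen]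
      push_cast
      have : (0:ℝ) ≤ h := by positivity
      nlinarith
    · intro x; have := hl6 x; have := hr6 x; have := norm_nonneg (ev A x - F x); positivity
    · rw [II_add (by fun_prop) (by fun_prop), II_add (by fun_prop) (by fun_prop)]
      have := hG.e2 hdn
      rw [pow_succ]
      linarith
    · intro x
      rw [SN_append, SN_cons, hnU]
      have a1 := hl8 x
      have a2 := hr8 x
      have a3 := hAF x
      have a4 := hSplit x
      push_cast
      have a5 : (h:ℝ) * F x = h * (F x * C.P false (m * x)) + h * (F x * C.P true (m * x)) := by
        rw [← mul_add, ← a4]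
      linarith
    · have hGl := GG_cont C.l Ll
      have hGr := GG_cont C.l Lr
      have hGa := GG_cont C.l (Ll ++ (U :: Lr))
      have hSl := SS_cont Ll
      have hMI := main_int C hG hdn m hm1 hmM hsep
      have hPP := C.PPm m hm1
      set J1 : ℝ → ℝ := fun x => wt C.l x * (F x * C.P false (m * x) * GG C.l Ll x) with hJ1
      set J2 : ℝ → ℝ := fun x => wt C.l x * (F x * C.P true (m * x) * GG C.l Lr x) with hJ2
      set J3 : ℝ → ℝ := fun x => wt C.l x * (F x * C.P true (m * x) * (trigChar C.l x * (trigChar m x * ev A x)).re) with hJ3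
      set J4 : ℝ → ℝ := fun x => 2 * (h * (C.P true (m * x) * C.P false (m * x))) with hJ4
      set J5 : ℝ → ℝ := fun x => 2 * El x with hJ5
      have c1 : Continuous J1 := by fun_prop
      have c2 : Continuous J2 := by fun_prop
      have c3 : Continuous J3 := by fun_prop
      have c4 : Continuous J4 := by fun_prop
      have c5 : Continuous J5 := by fun_prop
      have hmono : II (fun x => (J1 x + J2 x + J3 x) - (J4 x + J5 x)) ≤
          II (fun x => wt C.l x * (F x * GG C.l (Ll ++ (U :: Lr)) x)) := by
        apply II_mono (by fun_prop) (by fun_prop)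
        intro x
        simp only [hJ1, hJ2, hJ3, hJ4, hJ5]
        have g1 := GG_app1 C.l Ll (U :: Lr) x
        have g2 : (trigChar C.l x * SS Ll x).re + ((trigChar C.l x * (trigChar m x * ev A x)).re + GG C.l Lr x)
            ≤ GG C.l (Ll ++ (U :: Lr)) x := by
          refine le_trans ?_ (GG_app2 C.l Ll (U :: Lr) x)
          have : (trigChar C.l x * (trigChar m x * ev A x)).re + GG C.l Lr x ≤ GG C.l (U :: Lr) x := by
            simp only [GG]; rw [hUev]; exact le_max_right _ _
          linarith
        have g3 := (abs_le.mp (re_le_ev C.l (SS Ll x) x)).1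
        have g4 := SS_le Ll x
        have g5 := hl8 x
        have w0 := wt_nonneg C.l x
        have w2 := wt_le C.l x
        have f0 := hG.F0 x
        have f1 := hG.F1 x
        have p0 := C.hP0 true (m * x)
        have p1 := C.P1 true (m * x)
        have q0 := C.hP0 false (m * x)
        have q1 := C.P1 false (m * x)
        have e0 := hl6 x
        have sp := hSplit x
        have hh : (0:ℝ) ≤ h := by positivity
        generalize GG C.l (Ll ++ (U :: Lr)) x = G at *
        generalize GG C.l Ll x = Gl at *
        generalize GG C.l Lr x = Gr at *
        generalize (trigChar C.l x * SS Ll x).re = T at *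
        generalize (trigChar C.l x * (trigChar m x * ev A x)).re = V at *
        generalize C.P true (m * x) = p at *
        generalize C.P false (m * x) = q at *
        generalize wt C.l x = w at *
        generalize F x = f at *
        generalize El x = e at *
        have t1 : -(h * (f * q) + e) ≤ T := by linarith
        have t2 : f * q * Gl ≤ f * q * G := by gcongr
        have t3 : f * p * (-(h * (f * q) + e) + (V + Gr)) ≤ f * p * G := by
          apply mul_le_mul_of_nonneg_left _ (by positivity); linarith
        have t4 : f * p * (h * (f * q) + e) ≤ h * (p * q) + e := by
          have z1 : f * p * (h * (f * q)) ≤ h * (p * q) := by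
            calc f * p * (h * (f * q)) = (f * f) * (h * (p * q)) := by ring
              _ ≤ 1 * (h * (p * q)) := by gcongr; nlinarith
              _ = _ := one_mul _
          have z2 : f * p * e ≤ 1 * e := by gcongr; nlinarith
          linarith
        have t5 : f * q * Gl + f * p * (V + Gr) - (h * (p * q) + e) ≤ f * G := by
          have : f * G = f * q * G + f * p * G := by rw [← add_mul, ← sp]
          linarith
        have t6 := mul_le_mul_of_nonneg_left t5 w0
        have t7 : w * (h * (p * q) + e) ≤ 2 * (h * (p * q) + e) := by gcongr
        linarith
      rw [II_sub (by fun_prop) (by fun_prop), II_add (by fun_prop) c3, II_add c1 c2, II_add c4 c5] at hmono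
      have i4 : II J4 ≤ 2 * C.e0 := by
        rw [hJ4, II_mul, II_mul]
        have b1 := C.hδe
        have b2 := C.hδ0
        have b3 : (h:ℝ) ≤ C.n := by exact_mod_cast (by omega : h ≤ C.n)
        have b4 : (h:ℝ) * II (fun x => C.P true (m * x) * C.P false (m * x)) ≤ h * C.δ := by gcongr
        have b5 : (h:ℝ) * C.δ ≤ C.n * C.δ := by gcongr
        linarith
      have i5 : II J5 ≤ 2 * ((2 ^ h - 1) * C.e0) := by
        rw [hJ5, II_mul]; linarith
      have iF : II F = II (fun x => F x * C.P false (m * x)) + II (fun x => F x * C.P true (m * x)) := by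
        rw [← II_add (by fun_prop) (by fun_prop)]
        congr 1; funext x; exact hSplit x
      have e0 := C.e00
      have e1 : (2:ℝ) ^ h * C.e0 ≤ 4 ^ h * C.e0 := by gcongr; norm_num
      have e2 : C.e0 ≤ 4 ^ h * C.e0 := le_mul_of_one_le_left e0 (one_le_pow₀ (by norm_num))
      have iF2 : 1/16 * (h:ℝ) * II F = 1/16 * h * II (fun x => F x * C.P false (m * x)) + 1/16 * h * II (fun x => F x * C.P true (m * x)) := by
        rw [iF]; ring
      have e3 : 10 * 4 ^ (h+1) * C.e0 = 40 * (4 ^ h * C.e0) := by ring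
      rw [e3]
      push_cast
      linarith


lemma exp_small (t : ℝ) (ht : 1 ≤ t) :
    2 * t ^ 16 * Real.exp (-4 * (1 / t ^ 4) ^ 2 * t ^ 16) ≤ 1 / t ^ 4 := by
  have h1 : -4 * (1 / t ^ 4) ^ 2 * t ^ 16 = -(4 * t ^ 8) := by
    field_simp
  rw [h1, Real.exp_neg]
  have h2 := Real.pow_div_factorial_le_exp (4 * t ^ 8) (by positivity) 3
  have h3 : (4 * t ^ 8) ^ 3 / (Nat.factorial 3 : ℝ) = 32/3 * t ^ 24 := by
    norm_num [Nat.factorial]; ring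
  rw [h3] at h2
  have h4 : 2 * t ^ 20 ≤ Real.exp (4 * t ^ 8) := by
    refine le_trans ?_ h2
    have : t ^ 20 ≤ t ^ 24 := pow_le_pow_right₀ ht (by norm_num)
    have : 0 ≤ t ^ 24 := by positivity
    linarith
  rw [← div_eq_mul_inv, div_le_div_iff₀ (Real.exp_pos _) (by positivity)]
  calc 2 * t ^ 16 * t ^ 4 = 2 * t ^ 20 := by ring
    _ ≤ _ := by linarith

lemma M_bound (t : ℕ) (ht : 64 ≤ t) :
    t * t ^ 48 * t ^ 48 + (t ^ 48 + 1) * ((t ^ 48 + 1) * (4 * t ^ 16 + 5)) < t ^ 120 := by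
  have h1 : 1 ≤ t ^ 48 := Nat.one_le_pow _ _ (by omega)
  have h2 : 1 ≤ t ^ 16 := Nat.one_le_pow _ _ (by omega)
  calc _ ≤ t ^ 97 + (2 * t ^ 48) * ((2 * t ^ 48) * (9 * t ^ 16)) := by
        gcongr
        · apply le_of_eq; ring
        · omega
        · omega
        · omega
    _ = t ^ 97 + 36 * t ^ 112 := by ring
    _ ≤ t ^ 112 + 36 * t ^ 112 := by gcongr; omega; norm_num
    _ = 37 * t ^ 112 := by ring
    _ < 64 * t ^ 112 := by have : 0 < t ^ 112 := by positivity
                           omega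
    _ ≤ t * t ^ 112 := by gcongr
    _ = t ^ 113 := by ring
    _ ≤ t ^ 120 := by gcongr; omega; norm_num

lemma mk_cfg (n : ℕ) (hn : 6 ≤ n) (l : ℤ) (hl : ((2:ℤ) ^ n) ^ 140 < |l|) :
    ∃ C : Cfg, C.n = n ∧ C.s = (2 ^ n) ^ 48 ∧ C.D = (2 ^ n) ^ 16 ∧ C.M = (2 ^ n) ^ 120 ∧ C.l = l ∧
      C.e0 = n * (5 * (1 / ((2:ℝ) ^ n) ^ 4)) := by
  set t : ℝ := (2:ℝ) ^ n with ht
  have htn : (64:ℕ) ≤ 2 ^ n := by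
    calc 64 = 2 ^ 6 := by norm_num
      _ ≤ 2 ^ n := Nat.pow_le_pow_right (by norm_num) hn
  have ht64 : (64:ℝ) ≤ t := by rw [ht]; exact_mod_cast htn
  have ht0 : 0 < t := by linarith
  have hτ : 1 / t ^ 4 ≤ 1 / 8 := by
    apply one_div_le_one_div_of_le (by norm_num)
    have : t ^ 1 ≤ t ^ 4 := pow_le_pow_right₀ (by linarith) (by norm_num)
    linarith
  have hD1 : 1 ≤ (2 ^ n) ^ 16 := Nat.one_le_pow _ _ (by positivity)
  obtain ⟨P, p, h1, h2, h3, h4, ⟨r, hr1, hr2, hr3⟩, h5, h6, h7⟩ :=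
    split_fun ((2 ^ n) ^ 16) hD1 (1 / t ^ 4) (by positivity) hτ
  have hcast : (((2 ^ n) ^ 16 : ℕ) : ℝ) = t ^ 16 := by push_cast; rfl
  rw [hcast] at h7
  have hes := exp_small t (by linarith)
  refine ⟨⟨n, (2 ^ n) ^ 16, (2 ^ n) ^ 48, (2 ^ n) ^ 120, 1 / t ^ 24, n * (5 * (1 / t ^ 4)), 5 * (1 / t ^ 4),
    1 / t ^ 4, r, l, P, p, h1, h2, h3, h4, hr1, hr2, hr3, h5, h6, ?_, by positivity, by positivity, by positivity,
    ?_, M_bound _ htn, ?_, le_rfl, ?_, ?_, hD1⟩, rfl, rfl, rfl, rfl, rfl, rfl⟩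
  · linarith
  · push_cast
    rw [← ht]
    apply le_of_eq
    field_simp
  · have e1 : Real.sqrt (1 / t ^ 24) = 1 / t ^ 12 := by
      rw [show 1 / t ^ 24 = (1 / t ^ 12) ^ 2 by field_simp, Real.sqrt_sq (by positivity)]
    have e2 : (8:ℝ) ^ n = t ^ 3 := by
      rw [ht, ← pow_mul, mul_comm, pow_mul]; norm_num
    rw [e1, e2]
    rw [show (1 / t ^ 4) ^ 2 = 1 / t ^ 8 by field_simp, div_mul_eq_mul_div, one_mul,
      div_le_div_iff₀ (by positivity) (by positivity)]
    rw [one_mul, ← pow_add]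
    exact pow_le_pow_right₀ (by linarith) (by norm_num)
  · gcongr
    have : 0 < 1 / t ^ 4 := by positivity
    linarith
  · refine lt_of_le_of_lt ?_ hl
    push_cast
    have k1 : (n:ℤ) + 1 ≤ 2 ^ n := by exact_mod_cast Nat.lt_two_pow_self
    have k2 : (64:ℤ) ≤ 2 ^ n := by exact_mod_cast htn
    generalize (2:ℤ) ^ n = T at *
    have k3 : 1 ≤ T ^ 16 := one_le_pow₀ (by linarith)
    calc ((n:ℤ) + 1) * ((T ^ 16 + 1) * T ^ 120) ≤ T * ((2 * T ^ 16) * T ^ 120) := by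
          gcongr
          linarith
      _ = 2 * T ^ 137 := by ring
      _ ≤ T * T ^ 137 := by gcongr; linarith
      _ = T ^ 138 := by ring
      _ ≤ T ^ 140 := pow_le_pow_right₀ (by linarith) (by norm_num)

lemma level_set (G E : ℝ → ℝ) (hG : Continuous G) (hE : Continuous E) (hE0 : ∀ x, 0 ≤ E x)
    (n : ℝ) (hn : 0 < n) (hGE : ∀ x, G x ≤ n + E x) (hE1 : II E ≤ n / 512)
    (hint : n / 41 ≤ II G) :
    ENNReal.ofReal (1/128) ≤ volume {u ∈ Set.Ico (0:ℝ) 1 | n / 128 < G u} := by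
  set W := {u : ℝ | n / 128 < G u} with hW
  have hWm : MeasurableSet W := (isOpen_lt continuous_const hG).measurableSet
  have h1 : ∀ x, G x - n / 128 - E x ≤ W.indicator (fun _ => n) x := by
    intro x
    by_cases hx : x ∈ W
    · rw [Set.indicator_of_mem hx]; linarith [hGE x]
    · rw [Set.indicator_of_notMem hx]
      have : G x ≤ n / 128 := not_lt.mp hx
      linarith [hE0 x]
  have hind : IntervalIntegrable (W.indicator (fun _ => n)) volume 0 1 := by
    rw [intervalIntegrable_iff]
    apply Integrable.indicator _ hWm
    simp
  have h2 : II (fun x => G x - n / 128 - E x) ≤ ∫ x in (0:ℝ)..1, W.indicator (fun _ => n) x := by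
    apply intervalIntegral.integral_mono_on (by norm_num) _ hind fun x _ => h1 x
    apply Continuous.intervalIntegrable; fun_prop
  rw [II_sub (by fun_prop) hE, II_sub hG (by fun_prop), II_const,
    intervalIntegral.integral_of_le (by norm_num), integral_indicator hWm, setIntegral_const,
    measureReal_restrict_apply hWm, smul_eq_mul] at h2
  have h3 : 1 / 128 ≤ volume.real (W ∩ Set.Ioc 0 1) := by
    have : 1/128 * n ≤ volume.real (W ∩ Set.Ioc 0 1) * n := by linarith
    exact le_of_mul_le_mul_right this hn
  have h4 : volume (W ∩ Set.Ioc 0 1) ≤ volume {u ∈ Set.Ico (0:ℝ) 1 | n / 128 < G u} := by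
    have : W ∩ Set.Ioc 0 1 ⊆ {u ∈ Set.Ico (0:ℝ) 1 | n / 128 < G u} ∪ {1} := by
      rintro u ⟨hu, h0, h1⟩
      rcases h1.lt_or_eq with h | h
      · left; exact ⟨⟨h0.le, h⟩, hu⟩
      · right; exact h
    refine (measure_mono this).trans ((measure_union_le _ _).trans ?_)
    simp
  refine le_trans ?_ h4
  refine (ENNReal.ofReal_le_ofReal h3).trans ?_
  exact ENNReal.ofReal_toReal_le

lemma core (n : ℕ) (hn : 6 ≤ n) (l : ℤ) (hl : ((2:ℤ) ^ n) ^ 140 < |l|) :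
    ∃ L : List (ℤ →₀ ℂ), L.length + 1 = 2 ^ n ∧ L.Pairwise (fun U V => Disjoint U.support V.support) ∧
      (∀ U ∈ L, (∀ x, ‖ev U x‖ ≤ ((2:ℝ) ^ n) ^ 48) ∧ ∀ k ∈ U.support, |k| ≤ ((2:ℤ) ^ n) ^ 140) ∧
      (L.map en).sum ≤ n ∧
      ENNReal.ofReal (1/128) ≤ volume {u ∈ Set.Ico (0:ℝ) 1 | (n:ℝ) / 128 < GG l L u} := by
  obtain ⟨C, rfl, hCs, hCD, hCM, rfl, hCe⟩ := mk_cfg n hn l hl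
  have htn : (64:ℕ) ≤ 2 ^ C.n := by
    calc 64 = 2 ^ 6 := by norm_num
      _ ≤ 2 ^ C.n := Nat.pow_le_pow_right (by norm_num) hn
  have hen1 : en (Finsupp.single 0 1) = 1 := by
    unfold en; rw [Finsupp.support_single _ one_ne_zero]; simp
  have hev1 : ∀ x, ev (Finsupp.single 0 1) x = 1 := by
    intro x; unfold ev; rw [Finsupp.support_single _ one_ne_zero]; simp [tc_zero]
  have hη1 : C.η ≤ 1 := by
    have h1 := C.hγ
    have h2 := C.hγe
    have h3 := C.hγ0
    have hn0 : (6:ℝ) ≤ C.n := by exact_mod_cast hn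
    by_contra hc
    push Not at hc
    have h4 : 1 ≤ Real.sqrt C.η := by rw [Real.one_le_sqrt]; exact hc.le
    have h5 : (1:ℝ) ≤ 8 ^ C.n := one_le_pow₀ (by norm_num)
    have h6 : 1 ≤ C.γ ^ 2 := by nlinarith
    have h7 : 1 ≤ C.γ := by nlinarith
    have ht : (64:ℝ) ≤ 2 ^ C.n := by exact_mod_cast htn
    rw [hCe] at h2
    have h8 : C.γ ≤ 5 * (1 / ((2:ℝ) ^ C.n) ^ 4) := le_of_mul_le_mul_left h2 (by linarith)
    have h9 : (64:ℝ) ^ 4 ≤ ((2:ℝ) ^ C.n) ^ 4 := by gcongr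
    have h10 : 1 / ((2:ℝ) ^ C.n) ^ 4 ≤ 1 / 64 ^ 4 := one_div_le_one_div_of_le (by norm_num) h9
    rw [show (1:ℝ) / 64 ^ 4 = 1 / 16777216 by norm_num] at h10
    linarith
  have hroot : Good C 0 (fun _ => 1) (Finsupp.single 0 1) := by
    refine ⟨by fun_prop, by simp, by simp, ?_, ?_, ?_, ?_, hen1.le, ?_⟩
    · simp [II_const]
    · simp [hev1, II_const]
    · rw [Finsupp.support_single _ one_ne_zero]; simp [q32]
    · intro k hk
      rw [Finsupp.support_single _ one_ne_zero, Finset.mem_singleton] at hk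
      subst hk; simpa using hη1
    · intro k hk
      rw [Finsupp.support_single _ one_ne_zero, Finset.mem_singleton] at hk
      subst hk; simp
  obtain ⟨L, h1, h2, h3, h4, E, h5, h6, h7, h8, h9⟩ := tree C C.n 0 _ _ ∅ (by simp) hroot (by simp)
  refine ⟨L, h1, h2, ?_, ?_, ?_⟩
  · intro U hU
    obtain ⟨-, a1, a2, a3⟩ := h3 U hU
    constructor
    · intro x
      refine (ev_le U a2 x).trans ?_
      rw [hCs] at a1
      exact_mod_cast a1
    · intro k hk
      refine (a3 k hk).trans ?_
      rw [hCD, hCM]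
      push_cast
      have k1 : (C.n:ℤ) + 1 ≤ 2 ^ C.n := by exact_mod_cast Nat.lt_two_pow_self
      have k2 : (64:ℤ) ≤ 2 ^ C.n := by exact_mod_cast htn
      generalize (2:ℤ) ^ C.n = T at *
      have k3 : 0 ≤ T ^ 120 := by positivity
      calc (C.n:ℤ) * (T ^ 16 * T ^ 120) + T ^ 120 ≤ T * (T ^ 16 * T ^ 120) + T ^ 137 := by
            gcongr
            · linarith
            · linarith
            · norm_num
        _ = 2 * T ^ 137 := by ring
        _ ≤ T * T ^ 137 := by gcongr; linarith
        _ = T ^ 138 := by ring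
        _ ≤ T ^ 140 := pow_le_pow_right₀ (by linarith) (by norm_num)
  · rw [hen1] at h4; linarith
  · have hn0 : (6:ℝ) ≤ C.n := by exact_mod_cast hn
    have ht : (64:ℝ) ≤ 2 ^ C.n := by exact_mod_cast htn
    have e4 : (4:ℝ) ^ C.n = (2 ^ C.n) ^ 2 := by rw [← pow_mul, mul_comm, pow_mul]; norm_num
    have herr : (4:ℝ) ^ C.n * C.e0 ≤ C.n * (1/768) := by
      rw [hCe, e4]
      generalize (2:ℝ) ^ C.n = t at *
      have : t ^ 2 * (C.n * (5 * (1 / t ^ 4))) = C.n * (5 / t ^ 2) := by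
        field_simp
      rw [this]
      apply mul_le_mul_of_nonneg_left _ (by linarith)
      rw [div_le_div_iff₀ (by positivity) (by norm_num)]
      nlinarith
    have hc := C.e00
    have h2e : (2 ^ C.n - 1) * C.e0 ≤ 4 ^ C.n * C.e0 := by
      gcongr
      have : (2:ℝ) ^ C.n ≤ 4 ^ C.n := by gcongr; norm_num
      linarith
    have hGc := GG_cont C.l L
    have hw := wt_cont C.l
    apply level_set (GG C.l L) E hGc h5 h6 C.n (by linarith)
    · intro x
      have := h8 x
      have := GG_le C.l L x
      linarith
    · linarith
    · have : II (fun x => wt C.l x * (1 * GG C.l L x)) ≤ II (fun x => 2 * GG C.l L x) := by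
        apply II_mono (by fun_prop) (by fun_prop)
        intro x
        have := wt_le C.l x
        have := GG_nonneg C.l L x
        rw [one_mul]; gcongr
      rw [II_mul] at this
      rw [II_const] at h9
      linarith


lemma list_sum_getD {β : Type} [AddCommMonoid β] (g : (ℤ →₀ ℂ) → β) (hg : g 0 = 0) (L : List (ℤ →₀ ℂ)) (m : ℕ) :
    ∑ i ∈ Finset.Icc 1 m, g (L.getD (i - 1) 0) = ((L.take m).map g).sum := by
  have h1 : ∑ i ∈ Finset.Icc 1 m, g (L.getD (i - 1) 0) = ∑ i ∈ Finset.range m, g (L.getD i 0) := by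
    rw [Finset.range_eq_Ico, Finset.sum_Ico_eq_sum_range]
    have : Finset.Icc 1 m = Finset.Ico 1 (m + 1) := by ext; simp [Nat.lt_succ_iff]
    rw [this, Finset.sum_Ico_eq_sum_range]
    simp
  rw [h1]
  clear h1
  induction L generalizing m with
  | nil => simp [hg]
  | cons U L ih =>
    cases m with
    | zero => simp
    | succ m =>
      rw [Finset.sum_range_succ', List.take_succ_cons, List.map_cons, List.sum_cons, ← ih]
      simp [add_comm]

lemma list_coef (L : List (ℤ →₀ ℂ)) (hL : L.Pairwise (fun U V => Disjoint U.support V.support))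
    (U : ℤ →₀ ℂ) (hU : U ∈ L) (k : ℤ) (hk : k ∈ U.support) : (L.map (fun V => V k)).sum = U k := by
  induction L with
  | nil => simp at hU
  | cons V L ih =>
    rw [List.pairwise_cons] at hL
    rw [List.map_cons, List.sum_cons]
    rw [List.mem_cons] at hU
    rcases hU with rfl | hU
    · have : (L.map (fun V => V k)).sum = 0 := by
        apply List.sum_eq_zero
        intro z hz
        rw [List.mem_map] at hz
        obtain ⟨W, hW, rfl⟩ := hz
        exact Finsupp.notMem_support_iff.mp (Finset.disjoint_left.mp (hL.1 W hW) hk)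
      rw [this, add_zero]
    · rw [ih hL.2 hU, Finsupp.notMem_support_iff.mp (Finset.disjoint_right.mp (hL.1 U hU) hk), zero_add]

lemma getD_mem (L : List (ℤ →₀ ℂ)) (i : ℕ) : L.getD i 0 ∈ L ∨ L.getD i 0 = 0 := by
  by_cases h : i < L.length
  · left; rw [List.getD_eq_getElem _ _ h]; exact List.getElem_mem h
  · right; rw [List.getD_eq_default _ _ (by omega)]

lemma getD_disj (L : List (ℤ →₀ ℂ)) (hL : L.Pairwise (fun U V => Disjoint U.support V.support))
    (i j : ℕ) (hij : i ≠ j) : Disjoint (L.getD i 0).support (L.getD j 0).support := by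
  by_cases hi : i < L.length
  · by_cases hj : j < L.length
    · rw [List.getD_eq_getElem _ _ hi, List.getD_eq_getElem _ _ hj]
      rw [List.pairwise_iff_getElem] at hL
      rcases lt_or_gt_of_ne hij with h | h
      · exact hL i j hi hj h
      · exact (hL j i hj hi h).symm
    · rw [List.getD_eq_default _ _ (by omega : L.length ≤ j)]; simp
  · rw [List.getD_eq_default _ _ (by omega : L.length ≤ i)]; simp

lemma loc (L : List (ℤ →₀ ℂ)) (hL : L.Pairwise (fun U V => Disjoint U.support V.support))
    (Φ : ℝ → ℝ) (φ : ℤ → ℂ) (R : ℕ)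
    (hΦ : ∀ x, (Φ x : ℂ) = ∑ c ∈ Finset.Icc (-(R:ℤ)) R, φ c * trigChar c x) (l : ℤ) (K : ℝ) :
    ∃ (S : ℕ → Finset ℤ) (coef : ℤ → ℂ),
      (∀ n, ∀ j ∈ S n, ∃ U ∈ L, ∃ k ∈ U.support, ∃ r ∈ Finset.Icc (-(R:ℤ)) R, j = (2 * R + 1) * (l + k) + r) ∧
      (∀ n n' : ℕ, 1 ≤ n → 1 ≤ n' → n ≠ n' → Disjoint (S n) (S n')) ∧
      (∀ n x, ∑ j ∈ S n, coef j * trigChar j x = ((K * Φ x : ℝ) : ℂ) *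
        (trigChar l (((2 * R + 1 : ℤ) : ℝ) * x) * ev (L.getD (n - 1) 0) (((2 * R + 1 : ℤ) : ℝ) * x))) ∧
      (∀ n, ∑ j ∈ S n, ‖coef j‖ ^ 2 = K ^ 2 * (∑ c ∈ Finset.Icc (-(R:ℤ)) R, ‖φ c‖ ^ 2) * en (L.getD (n - 1) 0)) := by
  classical
  set q : ℤ := 2 * R + 1 with hq
  set ψ : ℤ × ℤ → ℤ := fun t => q * (l + t.1) + t.2 with hψ
  set kk : ℤ → ℤ := fun j => (j + R) / q - l with hkk
  set rr : ℤ → ℤ := fun j => (j + R) % q - R with hrr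
  have hdec : ∀ k r : ℤ, r ∈ Finset.Icc (-(R:ℤ)) R → kk (ψ (k, r)) = k ∧ rr (ψ (k, r)) = r := by
    intro k r hr
    rw [Finset.mem_Icc] at hr
    have e : q * (l + k) + r + R = (r + R) + q * (l + k) := by ring
    simp only [hkk, hrr, hψ]
    rw [e, Int.add_mul_ediv_left _ _ (by omega), Int.add_mul_emod_self_left,
      Int.ediv_eq_zero_of_lt (by omega) (by omega), Int.emod_eq_of_lt (by omega) (by omega)]
    constructor <;> ring
  have hinj : ∀ B : Finset ℤ, Set.InjOn ψ (B ×ˢ Finset.Icc (-(R:ℤ)) R : Finset (ℤ × ℤ)) := by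
    rintro B ⟨k, r⟩ h ⟨k', r'⟩ h' he
    rw [Finset.mem_coe, Finset.mem_product] at h h'
    have a := hdec k r h.2
    have a' := hdec k' r' h'.2
    rw [he] at a
    rw [Prod.mk.injEq]
    exact ⟨a.1.symm.trans a'.1, a.2.symm.trans a'.2⟩
  set coef : ℤ → ℂ := fun j => (K : ℂ) * (φ (rr j) * (L.map (fun V => V (kk j))).sum) with hcoef
  have hco : ∀ n k r, k ∈ (L.getD (n - 1) 0).support → r ∈ Finset.Icc (-(R:ℤ)) R →
      coef (ψ (k, r)) = K * (φ r * (L.getD (n - 1) 0) k) := by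
    intro n k r hk hr
    simp only [hcoef]
    rw [(hdec k r hr).1, (hdec k r hr).2]
    rcases getD_mem L (n - 1) with h | h
    · rw [list_coef L hL _ h k hk]
    · rw [h] at hk; simp at hk
  refine ⟨fun n => ((L.getD (n - 1) 0).support ×ˢ Finset.Icc (-(R:ℤ)) R).image ψ, coef, ?_, ?_, ?_, ?_⟩
  · intro n j hj
    rw [Finset.mem_image] at hj
    obtain ⟨⟨k, r⟩, h, rfl⟩ := hj
    rw [Finset.mem_product] at h
    rcases getD_mem L (n - 1) with h' | h'
    · exact ⟨_, h', k, h.1, r, h.2, rfl⟩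
    · rw [h'] at h; simp at h
  · intro n n' hn hn' hne
    have hd := getD_disj L hL (n - 1) (n' - 1) (by omega)
    rw [Finset.disjoint_left]
    intro j hj hj'
    rw [Finset.mem_image] at hj hj'
    obtain ⟨⟨k, r⟩, h, rfl⟩ := hj
    obtain ⟨⟨k', r'⟩, h', he⟩ := hj'
    rw [Finset.mem_product] at h h'
    have a := hdec k r h.2
    have a' := hdec k' r' h'.2
    rw [he, a.1] at a'
    have : k = k' := a'.1
    subst this
    exact Finset.disjoint_left.mp hd h.1 h'.1
  · intro n x
    rw [Finset.sum_image (fun a ha b hb hab => hinj _ ha hb hab), Finset.sum_product]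
    rw [Complex.ofReal_mul]
    unfold ev
    rw [Finset.mul_sum, Finset.mul_sum]
    apply Finset.sum_congr rfl
    intro k hk
    rw [hΦ, Finset.mul_sum, Finset.sum_mul]
    apply Finset.sum_congr rfl
    intro r hr
    rw [hco n k r hk hr]
    have e1 := tc_mul_arg l q x
    have e2 := tc_mul_arg k q x
    simp only [hψ]
    have e3 : trigChar (q * (l + k) + r) x = trigChar (l * q) x * trigChar (k * q) x * trigChar r x := by
      rw [← tc_add, ← tc_add]; congr 1; ring
    rw [e3, ← e1, ← e2]
    push_cast [hq]
    ring
  · intro n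
    rw [Finset.sum_image (fun a ha b hb hab => hinj _ ha hb hab), Finset.sum_product]
    unfold en
    rw [Finset.mul_sum]
    apply Finset.sum_congr rfl
    intro k hk
    rw [Finset.mul_sum, Finset.sum_mul]
    apply Finset.sum_congr rfl
    intro r hr
    rw [hco n k r hk hr, norm_mul, norm_mul, mul_pow, mul_pow, Complex.norm_real, Real.norm_eq_abs, sq_abs]
    ring

lemma GG_per (l : ℤ) (L : List (ℤ →₀ ℂ)) (x : ℝ) (i : ℤ) : GG l L (x + i) = GG l L x := by
  have ht : ∀ k, trigChar k (x + i) = trigChar k x := by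
    intro k; rw [tc_add_arg, tc_int, mul_one]
  induction L with
  | nil => simp [GG]
  | cons U L ih =>
    simp only [GG]
    rw [ih, ht]
    have : ev U (x + i) = ev U x := by
      unfold ev; simp only [ht]
    rw [this]

lemma per_meas (W : Set ℝ) (hW : MeasurableSet W) (hper : ∀ (x : ℝ) (i : ℤ), x + (i:ℝ) ∈ W ↔ x ∈ W) (v : ENNReal)
    (hv : v ≤ volume (W ∩ Set.Ico 0 1)) (k : ℕ) (i : ℤ) :
    k * v ≤ volume (W ∩ Set.Ico (i:ℝ) (i + k)) := by
  have h1 : ∀ j : ℤ, v ≤ volume (W ∩ Set.Ico (j:ℝ) (j + 1)) := by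
    intro j
    refine hv.trans (le_of_eq ?_)
    rw [← measure_preimage_add_right volume (j:ℝ) (W ∩ Set.Ico (j:ℝ) (j + 1))]
    congr 1
    ext x
    simp only [Set.mem_inter_iff, Set.mem_preimage, Set.mem_Ico, hper]
    constructor
    · rintro ⟨h, h0, h1⟩; exact ⟨h, by linarith, by linarith⟩
    · rintro ⟨h, h0, h1⟩; exact ⟨h, by linarith, by linarith⟩
  induction k with
  | zero => simp
  | succ k ih =>
    have hu : W ∩ Set.Ico (i:ℝ) (i + (k+1:ℕ)) =
        (W ∩ Set.Ico (i:ℝ) (i + k)) ∪ (W ∩ Set.Ico (((i + k : ℤ)):ℝ) (((i + k : ℤ)) + 1)) := by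
      rw [← Set.inter_union_distrib_left]
      push_cast
      rw [Set.Ico_union_Ico_eq_Ico (by simp) (by simp), add_assoc]
    rw [hu, measure_union _ (hW.inter measurableSet_Ico)]
    · push_cast
      rw [add_mul, one_mul]
      exact add_le_add ih (by have := h1 (i + k); push_cast at this; exact this)
    · apply Set.disjoint_of_subset Set.inter_subset_right Set.inter_subset_right
      push_cast
      rw [Set.disjoint_left]
      intro x hx hx'
      linarith [hx.2, hx'.1]

lemma scale_meas (W : Set ℝ) (hW : MeasurableSet W) (hper : ∀ (x : ℝ) (i : ℤ), x + (i:ℝ) ∈ W ↔ x ∈ W) (v : ℝ) (hv0 : 0 ≤ v)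
    (hv : ENNReal.ofReal v ≤ volume (W ∩ Set.Ico 0 1)) (q α β : ℝ) (hq : 0 < q) (hαβ : 4 ≤ q * (β - α)) :
    ENNReal.ofReal (v * (β - α) / 2) ≤ volume {x ∈ Set.Icc α β | q * x ∈ W} := by
  set i := ⌈q * α⌉ with hi
  have hi1 : q * α ≤ i := Int.le_ceil _
  have hi2 : (i:ℝ) < q * α + 1 := Int.ceil_lt_add_one _
  set k := ⌊q * (β - α) - 1⌋₊ with hk
  have hk1 : (k:ℝ) ≤ q * (β - α) - 1 := Nat.floor_le (by linarith)
  have hk2 : q * (β - α) - 1 < k + 1 := Nat.lt_floor_add_one _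
  have h1 := per_meas W hW hper _ hv k i
  have h2 : (fun x => q * x) ⁻¹' (W ∩ Set.Ico (i:ℝ) (i + k)) ⊆ {x ∈ Set.Icc α β | q * x ∈ W} := by
    rintro x ⟨hx, h3, h4⟩
    refine ⟨⟨?_, ?_⟩, hx⟩
    · exact le_of_mul_le_mul_left (by linarith) hq
    · exact le_of_mul_le_mul_left (by nlinarith) hq
  refine le_trans ?_ (measure_mono h2)
  rw [Real.volume_preimage_mul_left hq.ne']
  refine le_trans ?_ (mul_le_mul_right h1 _)
  rw [← ENNReal.ofReal_natCast, ← ENNReal.ofReal_mul (by positivity), ← ENNReal.ofReal_mul (by positivity)]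
  apply ENNReal.ofReal_le_ofReal
  rw [abs_of_pos (by positivity)]
  have h5 : q * (β - α) / 2 ≤ k := by linarith
  have h6 : (β - α) / 2 ≤ q⁻¹ * k := by
    rw [inv_mul_eq_div, le_div_iff₀ hq]; linarith
  nlinarith


lemma fin_N0 (m : ℕ) : ∃ N₀ : ℕ, ∀ N : ℕ, N₀ < N → m ≤ Nat.log 2 N :=
  ⟨2 ^ m, fun N h => Nat.le_log_of_pow_le (by norm_num) h.le⟩

lemma fin_log (N : ℕ) (hN : N ≠ 0) (n : ℕ) (hn : n = Nat.log 2 N / 200) (hn1 : 1 ≤ n) :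
    ((2:ℕ) ^ n) ^ 200 ≤ N ∧ Real.log N ≤ 400 * n := by
  have h1 : n * 200 ≤ Nat.log 2 N := by omega
  have h2 : Nat.log 2 N < n * 200 + 200 := by omega
  constructor
  · rw [← pow_mul]
    exact (Nat.pow_le_pow_right (by norm_num) h1).trans (Nat.pow_log_le_self 2 hN)
  · have h3 : N < 2 ^ (Nat.log 2 N + 1) := Nat.lt_pow_succ_log_self (by norm_num) N
    have h4 : (N:ℝ) ≤ (2:ℝ) ^ (Nat.log 2 N + 1) := by exact_mod_cast h3.le
    have h5 : Real.log N ≤ Real.log ((2:ℝ) ^ (Nat.log 2 N + 1)) :=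
      Real.log_le_log (by exact_mod_cast Nat.pos_of_ne_zero hN) h4
    rw [Real.log_pow] at h5
    have h6 : Real.log 2 ≤ 1 := by linarith [Real.log_two_lt_d9]
    have h7 : ((Nat.log 2 N + 1 : ℕ) : ℝ) ≤ 400 * n := by
      have : Nat.log 2 N + 1 ≤ 400 * n := by omega
      exact_mod_cast this
    have h8 : ((Nat.log 2 N + 1 : ℕ) : ℝ) * Real.log 2 ≤ ((Nat.log 2 N + 1 : ℕ) : ℝ) * 1 :=
      mul_le_mul_of_nonneg_left h6 (by positivity)
    linarith

lemma fin_exp (N : ℝ) (hN : 0 < N) : 2 * N ^ 2 * Real.exp (-(N / 16)) ≤ 3145728 / N ^ 2 := by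
  have h := Real.pow_div_factorial_le_exp (N / 16) (by positivity) 4
  have h24 : ((Nat.factorial 4 : ℕ) : ℝ) = 24 := by norm_num [Nat.factorial]
  rw [h24] at h
  rw [Real.exp_neg, le_div_iff₀ (by positivity), ← div_eq_mul_inv, div_mul_eq_mul_div,
    div_le_iff₀ (Real.exp_pos _)]
  have e : (N / 16) ^ 4 / 24 = N ^ 4 / 1572864 := by ring
  rw [e] at h
  nlinarith

lemma fin_l (N : ℤ) (hN : 100 ≤ N) (l : ℤ) : ∃ l' : ℤ, N < |l'| ∧ ∀ k r : ℤ, |k| ≤ N → |r| ≤ N ^ 2 →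
    l < (2 * N ^ 2 + 1) * (l' + k) + r ∧ (2 * N ^ 2 + 1) * (l' + k) + r ≤ l + N ^ 5 := by
  set q : ℤ := 2 * N ^ 2 + 1 with hq
  have hq0 : 0 < q := by positivity
  have h0 := Int.emod_add_mul_ediv l q
  have h1 := Int.emod_nonneg l hq0.ne'
  have h2 := Int.emod_lt_of_pos l hq0
  have key : ∀ l' : ℤ, l / q + 2 * N ≤ l' → l' ≤ l / q + 4 * N + 1 → ∀ k r : ℤ, |k| ≤ N → |r| ≤ N ^ 2 →
    l < q * (l' + k) + r ∧ q * (l' + k) + r ≤ l + N ^ 5 := by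
    intro l' ha hb k r hk hr
    rw [abs_le] at hk hr
    have h3 : q * (l / q + N) ≤ q * (l' + k) := mul_le_mul_of_nonneg_left (by linarith) hq0.le
    have h4 : q * (l' + k) ≤ q * (l / q + 5 * N + 1) := mul_le_mul_of_nonneg_left (by linarith) hq0.le
    have h5 : 100 * q ≤ q * N := by nlinarith
    have h6 : q * (5 * N + 1) + N ^ 2 ≤ N ^ 5 := by
      have : N ^ 2 * 1000000 ≤ N ^ 5 := by
        have : (100:ℤ) ^ 3 ≤ N ^ 3 := pow_le_pow_left₀ (by norm_num) hN 3
        nlinarith [sq_nonneg N]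
      have h7 : N ^ 3 * 10000 ≤ N ^ 5 := by
        have : (100:ℤ) ^ 2 ≤ N ^ 2 := pow_le_pow_left₀ (by norm_num) hN 2
        nlinarith [pow_pos (by linarith : 0 < N) 3]
      have h8 : N * 1 ≤ N ^ 3 := by nlinarith [sq_nonneg N]
      have h9 : N * 1 ≤ N ^ 2 := by nlinarith
      rw [hq]
      nlinarith
    constructor
    · nlinarith
    · nlinarith
  by_cases h : N < |l / q + 2 * N|
  · exact ⟨_, h, key _ le_rfl (by linarith)⟩
  · refine ⟨l / q + 4 * N + 1, ?_, key _ (by linarith) le_rfl⟩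
    rw [not_lt, abs_le] at h
    exact lt_of_lt_of_le (by linarith) (le_abs_self _)

lemma fin_energy (Φ : ℝ → ℝ) (φ : ℤ → ℂ) (R : ℕ) (hc : Continuous Φ)
    (hΦ : ∀ x, (Φ x : ℂ) = ∑ c ∈ Finset.Icc (-(R:ℤ)) R, φ c * trigChar c x)
    (h0 : ∀ x, 0 ≤ Φ x) (h1 : ∀ x, Φ x ≤ 1) :
    ∑ c ∈ Finset.Icc (-(R:ℤ)) R, ‖φ c‖ ^ 2 ≤ (φ 0).re := by
  have hp := parseval (Finset.Icc (-(R:ℤ)) R) (fun c => c) φ (fun a _ b _ h => h)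
  have hi := tsum_integral (Finset.Icc (-(R:ℤ)) R) (fun c => c) φ
  simp only [← hΦ] at hp hi
  rw [← hp]
  rw [Finset.sum_ite_eq' (Finset.Icc (-(R:ℤ)) R) 0 φ, if_pos (by simp)] at hi
  rw [← hi, ← II_re (by fun_prop)]
  apply II_mono (by fun_prop) (by fun_prop)
  intro x
  rw [Complex.norm_real, Real.norm_eq_abs, sq_abs, Complex.ofReal_re]
  nlinarith [h0 x, h1 x]

lemma SN_bound (L : List (ℤ →₀ ℂ)) (B : ℝ) (x : ℝ) (h : ∀ U ∈ L, ‖ev U x‖ ≤ B) : SN L x ≤ L.length * B := by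
  induction L with
  | nil => simp [SN_nil]
  | cons U L ih =>
    rw [SN_cons, List.length_cons]
    have h1 := h U (by simp)
    have h2 := ih (fun V hV => h V (by simp [hV]))
    push_cast
    linarith

lemma ev_zero (x : ℝ) : ev 0 x = 0 := by simp [ev]
lemma en_zero : en 0 = 0 := by simp [en]


set_option maxHeartbeats 2000000 in
lemma fin_main (N : ℕ) (n : ℕ) (hn : n = Nat.log 2 N / 200) (hn6 : 6 ≤ n) (hN : 10 ^ 4 ≤ N) (a b : ℝ)
    (hsub : Set.Ico a b ⊆ Set.Ico (0:ℝ) 1) (hba : 1 / Real.sqrt N ≤ b - a) (l : ℤ) :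
    ∃ (S : ℕ → Finset ℤ) (coef : ℤ → ℂ),
          (∀ n ∈ Finset.Icc 1 N, ∀ j ∈ S n, l < j ∧ j ≤ l + (N : ℤ) ^ 5) ∧
          (∀ n ∈ Finset.Icc 1 N, ∀ n' ∈ Finset.Icc 1 N, n ≠ n' → Disjoint (S n) (S n')) ∧
          l2normT (fun x => ∑ n ∈ Finset.Icc 1 N, ∑ j ∈ S n, coef j * trigChar j x) ≤
            (5376 * 3145728) * Real.sqrt (b - a) ∧
          (∀ x ∈ Set.Ico (0:ℝ) 1 \ Set.Ico a b,
            ∑ n ∈ Finset.Icc 1 N, ‖∑ j ∈ S n, coef j * trigChar j x‖ ≤ (5376 * 3145728) / N) ∧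
          ENNReal.ofReal (1 / 512 * (b - a)) ≤
            volume {x ∈ Set.Ico a b | Real.sqrt (Real.log N) <
              ⨆ m : Finset.Icc 1 N,
                (∑ n ∈ Finset.Icc 1 (m : ℕ), ∑ j ∈ S n, coef j * trigChar j x).re} := by
  classical
  have hN0 : N ≠ 0 := by omega
  have hNr : (10 ^ 4 : ℝ) ≤ N := by exact_mod_cast hN
  have hNp : (0:ℝ) < N := by positivity
  have hsN : 0 < Real.sqrt N := Real.sqrt_pos.mpr hNp
  have hsq : Real.sqrt N ^ 2 = N := Real.sq_sqrt hNp.le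
  have hdpos : 0 < b - a := lt_of_lt_of_le (by positivity) hba
  have hab : a < b := by linarith
  obtain ⟨ha0, hb1⟩ := (Set.Ico_subset_Ico_iff hab).mp hsub
  have hd2 : 1 ≤ N * (b - a) ^ 2 := by
    have h : 1 ≤ Real.sqrt N * (b - a) := by
      rw [div_le_iff₀ hsN] at hba; linarith
    have : 1 ≤ (Real.sqrt N * (b - a)) ^ 2 := one_le_pow₀ h
    rw [mul_pow, hsq] at this
    exact this
  obtain ⟨hT, hlog⟩ := fin_log N hN0 n hn (by omega)
  have hT1 : 1 ≤ 2 ^ n := Nat.one_le_two_pow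
  have hT140 : ((2:ℕ) ^ n) ^ 140 ≤ N := (Nat.pow_le_pow_right hT1 (by norm_num)).trans hT
  have hT49 : ((2:ℕ) ^ n) ^ 49 ≤ N := (Nat.pow_le_pow_right hT1 (by norm_num)).trans hT
  have hT1' : (2:ℕ) ^ n ≤ N := by
    have := (Nat.pow_le_pow_right hT1 (by norm_num : 1 ≤ 200)).trans hT
    simpa using this
  have hT140z : ((2:ℤ) ^ n) ^ 140 ≤ N := by exact_mod_cast hT140
  have hT49r : ((2:ℝ) ^ n) ^ 49 ≤ N := by exact_mod_cast hT49
  obtain ⟨l', hl', hspec⟩ := fin_l N (by omega) l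
  obtain ⟨L, hlen, hdisj, hUb, hen, hmeas⟩ := core n hn6 l' (by linarith)
  set τ := (b - a) / 8 with hτ
  have hR1 : 1 ≤ N ^ 2 := Nat.one_le_pow _ _ (by omega)
  obtain ⟨Φ, φ, hΦc, hΦ, hΦ0, hΦ1, -, -, hφ0, -, hout, hin⟩ :=
    smooth_ind (a + τ) (b - τ) (by linarith) (by linarith) (N ^ 2) hR1
  have hnr : (6:ℝ) ≤ n := by exact_mod_cast hn6
  have hnp : (0:ℝ) < n := by linarith
  have hsn : 1 ≤ Real.sqrt n := by rw [Real.one_le_sqrt]; linarith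
  have hsnp : 0 < Real.sqrt n := by linarith
  have hsnsq : Real.sqrt n ^ 2 = n := Real.sq_sqrt hnp.le
  set K : ℝ := 5376 / Real.sqrt n with hK
  have hK0 : 0 < K := by positivity
  have hK1 : K ≤ 5376 := div_le_self (by norm_num) hsn
  have hK2 : K ^ 2 * n = 5376 ^ 2 := by
    rw [hK, div_pow, hsnsq]; field_simp
  have hexp : 2 * ((N ^ 2 : ℕ) : ℝ) * Real.exp (-4 * τ ^ 2 * ((N ^ 2 : ℕ) : ℝ)) ≤ 3145728 / (N:ℝ) ^ 2 := by
    refine le_trans ?_ (fin_exp N hNp)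
    push_cast
    apply mul_le_mul_of_nonneg_left _ (by positivity)
    apply Real.exp_le_exp.mpr
    rw [hτ]
    nlinarith
  have hlen' : L.length ≤ N := by omega
  have hlenr : (L.length : ℝ) ≤ 2 ^ n := by
    have : L.length ≤ 2 ^ n := by omega
    exact_mod_cast this
  have htake : L.take N = L := List.take_of_length_le hlen'
  obtain ⟨S, coef, hS1, hS2, hS3, hS4⟩ := loc L hdisj Φ φ (N ^ 2) hΦ l' K
  set q : ℝ := (((2 * ((N ^ 2 : ℕ):ℤ) + 1 : ℤ)) : ℝ) with hq
  have hqv : q = 2 * (N:ℝ) ^ 2 + 1 := by rw [hq]; push_cast; ring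
  have hpart : ∀ (m : ℕ) x, ∑ n ∈ Finset.Icc 1 m, ∑ j ∈ S n, coef j * trigChar j x =
      ((K * Φ x : ℝ) : ℂ) * (trigChar l' (q * x) * SS (L.take m) (q * x)) := by
    intro m x
    rw [Finset.sum_congr rfl (fun i _ => hS3 i x), ← Finset.mul_sum, ← Finset.mul_sum,
      list_sum_getD (fun U => ev U (q * x)) (ev_zero _)]
    rfl
  refine ⟨S, coef, ?_, ?_, ?_, ?_, ?_⟩
  · intro i _ j hj
    obtain ⟨U, hU, k, hk, r, hr, rfl⟩ := hS1 i j hj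
    have h1 := (hUb U hU).2 k hk
    have h2 := hspec k r (by linarith) (by
      rw [Finset.mem_Icc] at hr
      rw [abs_le]
      push_cast at hr
      exact hr)
    push_cast
    exact h2
  · intro i hi i' hi' hne
    exact hS2 i i' (Finset.mem_Icc.mp hi).1 (Finset.mem_Icc.mp hi').1 hne
  · have hpd : (↑(Finset.Icc 1 N) : Set ℕ).PairwiseDisjoint S := by
      intro i hi i' hi' hne
      rw [Finset.mem_coe, Finset.mem_Icc] at hi hi'
      exact hS2 i i' hi.1 hi'.1 hne
    have hval : ∫ x in (0:ℝ)..1, ‖∑ n ∈ Finset.Icc 1 N, ∑ j ∈ S n, coef j * trigChar j x‖ ^ 2 ≤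
        5376 ^ 2 * (b - a) := by
      simp_rw [← Finset.sum_biUnion hpd]
      have hp := parseval ((Finset.Icc 1 N).biUnion S) (fun j => j) coef (fun a _ b _ h => h)
      rw [hp, Finset.sum_biUnion hpd, Finset.sum_congr rfl (fun i _ => hS4 i), ← Finset.mul_sum,
        list_sum_getD en en_zero, htake]
      have he := fin_energy Φ φ (N ^ 2) hΦc hΦ hΦ0 hΦ1
      rw [hφ0, Complex.ofReal_re] at he
      have he2 : ∑ c ∈ Finset.Icc (-((N ^ 2 : ℕ):ℤ)) ((N ^ 2 : ℕ) : ℤ), ‖φ c‖ ^ 2 ≤ b - a := by linarith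
      calc _ ≤ K ^ 2 * (b - a) * n := by
            apply mul_le_mul (mul_le_mul_of_nonneg_left he2 (by positivity)) hen
            · apply List.sum_nonneg
              intro z hz
              rw [List.mem_map] at hz
              obtain ⟨U, _, rfl⟩ := hz
              exact en_nonneg U
            · positivity
        _ = 5376 ^ 2 * (b - a) := by rw [← hK2]; ring
    unfold l2normT
    rw [← Real.sqrt_eq_rpow]
    calc _ ≤ Real.sqrt (5376 ^ 2 * (b - a)) := Real.sqrt_le_sqrt hval
      _ = 5376 * Real.sqrt (b - a) := by
        rw [Real.sqrt_mul (by positivity), Real.sqrt_sq (by norm_num)]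
      _ ≤ _ := by
        apply mul_le_mul_of_nonneg_right (by norm_num) (Real.sqrt_nonneg _)
  · intro x hx
    have hΦx : Φ x ≤ 3145728 / (N:ℝ) ^ 2 := by
      refine (hout x τ (by positivity) ?_).trans hexp
      intro s hs
      obtain ⟨⟨hx0, hx1⟩, hx2⟩ := hx
      rw [Set.mem_Icc] at hs
      rcases lt_or_ge x a with h | h
      · rw [abs_of_nonpos (by linarith)]
        constructor <;> linarith
      · have h' : b ≤ x := by
          by_contra hc
          exact hx2 ⟨h, lt_of_not_ge hc⟩
        rw [abs_of_nonneg (by linarith)]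
        constructor <;> linarith
    have hKΦ : 0 ≤ K * Φ x := mul_nonneg hK0.le (hΦ0 x)
    have e1 : ∑ n ∈ Finset.Icc 1 N, ‖∑ j ∈ S n, coef j * trigChar j x‖ = K * Φ x * SN L (q * x) := by
      have : ∀ i ∈ Finset.Icc 1 N, ‖∑ j ∈ S i, coef j * trigChar j x‖ =
          K * Φ x * ‖ev (L.getD (i - 1) 0) (q * x)‖ := by
        intro i _
        rw [hS3, norm_mul, norm_mul, tc_norm, one_mul, Complex.norm_real, Real.norm_eq_abs, abs_of_nonneg hKΦ]
      rw [Finset.sum_congr rfl this, ← Finset.mul_sum,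
        list_sum_getD (fun U => ‖ev U (q * x)‖) (by simp [ev_zero]), htake]
      rfl
    rw [e1]
    have hSN : SN L (q * x) ≤ N := by
      refine (SN_bound L _ _ (fun U hU => (hUb U hU).1 (q * x))).trans ?_
      calc (L.length : ℝ) * ((2:ℝ) ^ n) ^ 48 ≤ (2:ℝ) ^ n * ((2:ℝ) ^ n) ^ 48 :=
            mul_le_mul_of_nonneg_right hlenr (by positivity)
        _ = ((2:ℝ) ^ n) ^ 49 := by rw [← pow_succ']
        _ ≤ N := hT49r
    calc K * Φ x * SN L (q * x) ≤ K * Φ x * N := mul_le_mul_of_nonneg_left hSN hKΦ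
      _ ≤ 5376 * (3145728 / (N:ℝ) ^ 2) * N := by
          apply mul_le_mul_of_nonneg_right _ hNp.le
          exact mul_le_mul hK1 hΦx (hΦ0 x) (by norm_num)
      _ = _ := by field_simp
  · set W : Set ℝ := {u | (n:ℝ) / 128 < GG l' L u} with hW
    have hWm : MeasurableSet W := measurableSet_lt measurable_const (GG_cont l' L).measurable
    have hWper : ∀ (x : ℝ) (i : ℤ), x + (i:ℝ) ∈ W ↔ x ∈ W := by
      intro x i
      rw [hW, Set.mem_ofPred_eq, Set.mem_ofPred_eq, GG_per]
    have hWv : ENNReal.ofReal (1 / 128) ≤ volume (W ∩ Set.Ico 0 1) := by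
      refine hmeas.trans (measure_mono ?_)
      rintro u ⟨h1, h2⟩
      exact ⟨h2, h1⟩
    have hq4 : 4 ≤ q * ((b - 2 * τ) - (a + 2 * τ)) := by
      have e : (b - 2 * τ) - (a + 2 * τ) = (b - a) / 2 := by rw [hτ]; ring
      rw [e, hqv]
      have hd1 : b - a ≤ 1 := by linarith
      have : 1 ≤ N * (b - a) := by nlinarith
      nlinarith
    have hsm := scale_meas W hWm hWper (1 / 128) (by norm_num) hWv q (a + 2 * τ) (b - 2 * τ)
      (by rw [hqv]; positivity) hq4
    refine le_trans (le_of_eq ?_) (hsm.trans (measure_mono ?_))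
    · congr 1; rw [hτ]; ring
    · rintro x ⟨⟨hx1, hx2⟩, hxW⟩
      refine ⟨⟨by linarith, by linarith⟩, ?_⟩
      have hΦx : 1 / 2 ≤ Φ x := by
        refine le_trans ?_ (hin x τ (by positivity) ?_)
        · have : 3145728 / (N:ℝ) ^ 2 ≤ 1 / 2 := by
            have : (10 ^ 4 : ℝ) ^ 2 ≤ (N:ℝ) ^ 2 := pow_le_pow_left₀ (by norm_num) hNr 2
            rw [div_le_iff₀ (by positivity)]
            linarith
          linarith
        · intro s hs
          rw [Set.mem_Icc] at hs
          rw [abs_of_nonpos (by linarith)]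
          constructor <;> linarith
      have hxW' : (n:ℝ) / 128 < GG l' L (q * x) := hxW
      obtain ⟨j, hj, hGG⟩ := GG_attain l' L (q * x)
      have hj1 : 1 ≤ j := by
        by_contra hc
        have : j = 0 := by omega
        subst this
        rw [hGG] at hxW'
        simp [SS_nil] at hxW'
        linarith
      have hbig : Real.sqrt (Real.log N) < K * Φ x * GG l' L (q * x) := by
        have h1 : Real.sqrt (Real.log N) ≤ 20 * Real.sqrt n := by
          rw [show (20:ℝ) * Real.sqrt n = Real.sqrt (20 ^ 2 * n) by
            rw [Real.sqrt_mul (by norm_num), Real.sqrt_sq (by norm_num)]]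
          apply Real.sqrt_le_sqrt
          linarith
        have h2 : K * (1 / 2) * ((n:ℝ) / 128) = 21 * Real.sqrt n := by
          rw [hK]
          field_simp
          rw [hsnsq]; ring
        have h3 : K * (1 / 2) * ((n:ℝ) / 128) ≤ K * Φ x * GG l' L (q * x) := by
          apply mul_le_mul (mul_le_mul_of_nonneg_left hΦx hK0.le) hxW'.le (by positivity)
          exact mul_nonneg hK0.le (hΦ0 x)
        linarith
      have hval : (∑ n ∈ Finset.Icc 1 j, ∑ j ∈ S n, coef j * trigChar j x).re = K * Φ x * GG l' L (q * x) := by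
        rw [hpart, Complex.re_ofReal_mul, hGG]
      rw [← hval] at hbig
      refine lt_of_lt_of_le hbig ?_
      exact le_ciSup (f := fun m : Finset.Icc 1 N =>
        (∑ n ∈ Finset.Icc 1 (m : ℕ), ∑ j ∈ S n, coef j * trigChar j x).re) (Set.finite_range _).bddAbove
        ⟨j, Finset.mem_Icc.mpr ⟨hj1, hj.trans hlen'⟩⟩

end

/-- Localization lemma: for an interval `Δ = [a,b) ⊆ [0,1)` with `|Δ| ≥ 1/√N` and any `l`,
there are non-overlapping trigonometric polynomials `U₁,…,U_N` with spectra in `(l, l+N⁵]`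
which are `L²`-small globally, tiny outside `Δ`, and whose maximal partial sums (real parts)
exceed `√(log N)` on a proportion of `Δ`. -/
theorem statement17 :
    ∃ C c : ℝ, 0 < C ∧ 0 < c ∧ ∃ N₀ : ℕ, ∀ N : ℕ, N₀ < N → ∀ a b : ℝ,
      Set.Ico a b ⊆ Set.Ico (0:ℝ) 1 → 1 / Real.sqrt N ≤ b - a → ∀ l : ℤ,
        ∃ (S : ℕ → Finset ℤ) (coef : ℤ → ℂ),
          (∀ n ∈ Finset.Icc 1 N, ∀ j ∈ S n, l < j ∧ j ≤ l + (N : ℤ) ^ 5) ∧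
          (∀ n ∈ Finset.Icc 1 N, ∀ n' ∈ Finset.Icc 1 N, n ≠ n' → Disjoint (S n) (S n')) ∧
          l2normT (fun x => ∑ n ∈ Finset.Icc 1 N, ∑ j ∈ S n, coef j * trigChar j x) ≤
            C * Real.sqrt (b - a) ∧
          (∀ x ∈ Set.Ico (0:ℝ) 1 \ Set.Ico a b,
            ∑ n ∈ Finset.Icc 1 N, ‖∑ j ∈ S n, coef j * trigChar j x‖ ≤ C / N) ∧
          ENNReal.ofReal (c * (b - a)) ≤
            volume {x ∈ Set.Ico a b | Real.sqrt (Real.log N) <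
              ⨆ m : Finset.Icc 1 N,
                (∑ n ∈ Finset.Icc 1 (m : ℕ), ∑ j ∈ S n, coef j * trigChar j x).re} := by
  obtain ⟨N₀, hN₀⟩ := fin_N0 1200
  refine ⟨5376 * 3145728, 1 / 512, by norm_num, by norm_num, N₀ + 10 ^ 4, ?_⟩
  intro N hN a b hsub hba l
  have h1 := hN₀ N (by omega)
  exact fin_main N _ rfl (by omega) (by omega) a b hsub hba l
end

section
/- Let w(n) be an increasing sequence of positive real numbers with ∑_{n=1}^∞ 1/(n·w(n)) = ∞, and set ν_k = 2^{50^k} for k ≥ 1. Then there exists a set G ⊂ ℕ of positive integers such that w(ν_{k+1}) < 100·w(ν_k) for every k ∈ G, and ∑_{k∈G} 50^k / w(ν_k) = ∞. -/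
open Filter

lemma aux_rec (c g : ℕ → ℝ) (hc : ∀ k, 0 ≤ c k) (hg : ∀ k, 0 ≤ g k) (hs : Summable g)
    (h : ∀ k, c (k + 1) ≤ c k / 2 + 50 * g k) : Summable c := by
  apply summable_of_sum_range_le (c := 2 * (c 0 + 50 * ∑' k, g k)) hc
  intro n
  have hT : 0 ≤ ∑' k, g k := tsum_nonneg hg
  have h1 : ∑ k ∈ Finset.range (n + 1), c k
      ≤ (∑ k ∈ Finset.range n, c k) / 2 + 50 * (∑ k ∈ Finset.range n, g k) + c 0 := by
    rw [Finset.sum_range_succ', Finset.sum_div, Finset.mul_sum, ← Finset.sum_add_distrib]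
    gcongr with i hi
    exact h i
  have h2 : ∑ k ∈ Finset.range n, g k ≤ ∑' k, g k := hs.sum_le_tsum _ (fun i _ => hg i)
  rw [Finset.sum_range_succ] at h1
  linarith [hc n]

/-- If `w(n)` is increasing and positive with `∑ 1/(n w(n)) = ∞`, and `ν_k = 2^{50^k}`, then
there is a set `G` of positive integers with `w(ν_{k+1}) < 100 w(ν_k)` for `k ∈ G` and
`∑_{k ∈ G} 50^k / w(ν_k) = ∞`. -/
theorem statement18 (w : ℕ → ℝ) (hpos : ∀ n, 1 ≤ n → 0 < w n)
    (hmono : ∀ m n, 1 ≤ m → m ≤ n → w m ≤ w n)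
    (hdiv : ¬ Summable (fun n : ℕ => 1 / ((n : ℝ) * w n))) :
    ∃ G : Set ℕ, (∀ k ∈ G, 1 ≤ k) ∧
      (∀ k ∈ G, w (2 ^ 50 ^ (k + 1)) < 100 * w (2 ^ 50 ^ k)) ∧
      Tendsto (fun M : ℕ =>
          ∑ k ∈ Finset.Icc 1 M, Set.indicator G (fun k => (50 : ℝ) ^ k / w (2 ^ 50 ^ k)) k)
        atTop atTop := by
  have hp2 : ∀ j : ℕ, 0 < w (2 ^ j) := fun j => hpos _ Nat.one_le_two_pow
  have hm2 : ∀ i j : ℕ, i ≤ j → w (2 ^ i) ≤ w (2 ^ j) := fun i j h =>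
    hmono _ _ Nat.one_le_two_pow (Nat.pow_le_pow_right (by norm_num) h)
  have hb : ¬ Summable (fun j : ℕ => 1 / w (2 ^ j)) := by
    intro hs
    apply hdiv
    rw [← summable_condensed_iff_of_nonneg]
    · convert hs using 2 with j
      have := (hp2 j).ne'
      push_cast
      field_simp
    · intro n
      rcases Nat.eq_zero_or_pos n with rfl | hn
      · simp
      · have := hpos n hn
        positivity
    · intro m n hm hmn
      have h1 := hpos m hm
      have h2 := hmono m n hm hmn
      have h3 : (0 : ℝ) < m := by exact_mod_cast hm
      have h4 : (m : ℝ) ≤ n := by exact_mod_cast hmn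
      apply one_div_le_one_div_of_le (by positivity)
      gcongr
  set a : ℕ → ℝ := fun k => (50 : ℝ) ^ k / w (2 ^ 50 ^ k) with ha
  have ha0 : ∀ k, 0 ≤ a k := fun k => by have := hp2 (50 ^ k); simp only [ha]; positivity
  have hna : ¬ Summable a := by
    intro hs
    apply hb
    have := summable_schlomilch_iff_of_nonneg (C := 50) (u := fun k => 50 ^ k)
      (f := fun j : ℕ => 1 / w (2 ^ j)) (fun n => by have := hp2 n; positivity)
      (fun m n hm hmn => one_div_le_one_div_of_le (hp2 m) (hm2 m n hmn))
      (fun n => by positivity) (pow_right_strictMono₀ (by norm_num)) (by norm_num)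
      (fun n => by simp only [smul_eq_mul, pow_succ]; omega)
    rw [← this]
    refine (hs.mul_left 49).congr fun k => ?_
    simp only [ha]
    push_cast
    ring
  let G : Set ℕ := {k | 1 ≤ k ∧ w (2 ^ 50 ^ (k + 1)) < 100 * w (2 ^ 50 ^ k)}
  have hg0 : ∀ k, 0 ≤ G.indicator a k := fun k => Set.indicator_nonneg (fun k _ => ha0 k) k
  have hnG : ¬ Summable (G.indicator a) := by
    intro hs
    apply hna
    rw [← summable_nat_add_iff 1]
    refine aux_rec _ (fun k => G.indicator a (k + 1)) (fun k => ha0 _) (fun k => hg0 _)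
      ((summable_nat_add_iff 1).2 hs) ?_
    intro k
    have p1 := hp2 (50 ^ (k + 1))
    have p2 := hp2 (50 ^ (k + 1 + 1))
    by_cases hk : k + 1 ∈ G
    · have : a (k + 1 + 1) ≤ 50 * a (k + 1) := by
        simp only [ha]
        rw [pow_succ (50 : ℝ) (k + 1), mul_comm, mul_div_assoc]
        gcongr
        exact hm2 _ _ (Nat.pow_le_pow_right (by norm_num) (by omega))
      simp only [Set.indicator_of_mem hk]
      linarith [ha0 (k + 1)]
    · have h1 : 100 * w (2 ^ 50 ^ (k + 1)) ≤ w (2 ^ 50 ^ (k + 1 + 1)) := by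
        by_contra hh
        exact hk ⟨by omega, not_le.1 hh⟩
      simp only [Set.indicator_of_notMem hk, mul_zero, add_zero, ha]
      rw [div_div, div_le_div_iff₀ p2 (by positivity), pow_succ (50 : ℝ) (k + 1)]
      have : (0 : ℝ) < 50 ^ (k + 1) := by positivity
      nlinarith
  refine ⟨G, fun k hk => hk.1, fun k hk => hk.2, ?_⟩
  have ht := (not_summable_iff_tendsto_nat_atTop_of_nonneg hg0).1 hnG
  have ht' := ht.comp (tendsto_add_atTop_nat 1)
  refine ht'.congr fun M => ?_
  have h0 : G.indicator a 0 = 0 := Set.indicator_of_notMem (fun h => by simpa using h.1) _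
  simp only [Function.comp]
  rw [Finset.range_eq_Ico, Finset.sum_eq_sum_Ico_succ_bot (by omega), h0, zero_add]
  rfl
end
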